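/- arXiv:2509.06090 — 5 statements merged into one kernel-verified Lean document; each statement's English description precedes it below -/
import Mathlib

section
/- L^p bound for the linearized magnetic potential: there is a constant C > 0 such that for every 2 ≤ p ≤ ∞, ‖a_θ/sinh(r)‖_{L^p} ≤ C(1 + ‖ε‖_{L^∞})(‖ε‖_{L^∞} + ‖ε‖_{L^p}). -/
/- L^p bound for the linearized magnetic potential a_θ/sinh(r). -/

open MeasureTheory Set Filter
open scoped ENNReal NNReal Topology

noncomputable section

/-- Weighted `L^p` norm on the half line: `(∫₀^∞ |F|^p sinh r dr)^{1/p}`. -/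
def wLp {E : Type*} [NNNorm E] (p : ℝ) (F : ℝ → E) : ℝ≥0∞ :=
  (∫⁻ r in Set.Ioi (0:ℝ), (‖F r‖₊ : ℝ≥0∞) ^ p * ENNReal.ofReal (Real.sinh r)) ^ (1/p)

/-- Weighted `L^∞` norm on the half line (essential supremum on `(0,∞)`). -/
def wLinf {E : Type*} [NNNorm E] (F : ℝ → E) : ℝ≥0∞ :=
  essSup (fun r => (‖F r‖₊ : ℝ≥0∞)) (volume.restrict (Set.Ioi (0:ℝ)))

/-- The linearized magnetic potential
`a_θ(r) = −∫₀^r Q Re ε sinh − (1/2)∫₀^r |ε|² sinh`. -/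
def atheta (Q : ℝ → ℝ) (ε : ℝ → ℂ) (r : ℝ) : ℝ :=
  -(∫ s in Set.Ioc (0:ℝ) r, Q s * (ε s).re * Real.sinh s)
    - (1/2) * ∫ s in Set.Ioc (0:ℝ) r, ‖ε s‖^2 * Real.sinh s

/-- Jensen's inequality for a finite measure, in the form supplied by Hölder's inequality. -/
lemma lintegral_rpow_le_lintegral_rpow_mul {α : Type*} [MeasurableSpace α] (μ : Measure α)
    {p : ℝ} (hp : 1 < p) {f : α → ℝ≥0∞} (hf : AEMeasurable f μ) :
    (∫⁻ a, f a ∂μ) ^ p ≤ (∫⁻ a, f a ^ p ∂μ) * μ univ ^ (p - 1) := by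
  have hpq := Real.HolderConjugate.conjExponent hp
  have h := ENNReal.lintegral_mul_le_Lp_mul_Lq μ hpq hf (aemeasurable_const (b := (1 : ℝ≥0∞)))
  simp only [Pi.mul_apply, mul_one, ENNReal.one_rpow, lintegral_one] at h
  have hp0 : 0 < p := by linarith
  refine (ENNReal.rpow_le_rpow h hp0.le).trans (le_of_eq ?_)
  rw [ENNReal.mul_rpow_of_nonneg _ _ hp0.le, ← ENNReal.rpow_mul, ← ENNReal.rpow_mul,
    one_div_mul_cancel hp0.ne', ENNReal.rpow_one]
  congr 2
  have : p - 1 ≠ 0 := by linarith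
  rw [Real.conjExponent]
  field_simp

lemma lintegral_cosh_half_Ioc {r : ℝ} (hr : 0 ≤ r) :
    ∫⁻ s in Ioc 0 r, ENNReal.ofReal (Real.cosh (s / 2)) =
      ENNReal.ofReal (2 * Real.sinh (r / 2)) := by
  have hc : Continuous fun s : ℝ => Real.cosh (s / 2) := by fun_prop
  rw [← ofReal_integral_eq_lintegral_ofReal (hc.integrableOn_Ioc)
    (ae_of_all _ fun s => (Real.cosh_pos _).le), ← intervalIntegral.integral_of_le hr,
    intervalIntegral.integral_eq_sub_of_hasDerivAt (f := fun s => 2 * Real.sinh (s / 2))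
      _ (hc.intervalIntegrable _ _)]
  · simp
  · intro x _
    have := ((Real.hasDerivAt_sinh (x / 2)).comp x ((hasDerivAt_id x).div_const 2)).const_mul 2
    exact this.congr_deriv (by ring)

lemma lintegral_sinh_Ioc {r : ℝ} (hr : 0 ≤ r) :
    ∫⁻ s in Ioc 0 r, ENNReal.ofReal (Real.sinh s) = ENNReal.ofReal (Real.cosh r - 1) := by
  rw [← ofReal_integral_eq_lintegral_ofReal Real.continuous_sinh.integrableOn_Ioc
    ((ae_restrict_mem measurableSet_Ioc).mono fun s hs => Real.sinh_nonneg_iff.2 hs.1.le),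
    ← intervalIntegral.integral_of_le hr,
    intervalIntegral.integral_eq_sub_of_hasDerivAt (f := Real.cosh)
      (fun x _ => Real.hasDerivAt_cosh x) (Real.continuous_sinh.intervalIntegrable _ _)]
  simp

lemma lintegral_cosh_half_div_sinh_half_sq_Ioi {s : ℝ} (hs : 0 < s) :
    ∫⁻ r in Ioi s, ENNReal.ofReal (Real.cosh (r / 2) / Real.sinh (r / 2) ^ 2) =
      ENNReal.ofReal (2 / Real.sinh (s / 2)) := by
  have hderiv : ∀ x ∈ Ici s, HasDerivAt (fun r => -(2 / Real.sinh (r / 2)))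
      (Real.cosh (x / 2) / Real.sinh (x / 2) ^ 2) x := by
    intro x hx
    have hS : Real.sinh (x / 2) ≠ 0 := (Real.sinh_pos_iff.2 (by have : s ≤ x := hx; linarith)).ne'
    have h1 := (Real.hasDerivAt_sinh (x / 2)).comp x ((hasDerivAt_id x).div_const 2)
    have h2 := ((h1.inv hS).const_mul 2).neg
    refine h2.congr_deriv ?_
    simp only [Function.comp_apply, id]
    field_simp
  have hnonneg : ∀ x : ℝ, 0 ≤ Real.cosh (x / 2) / Real.sinh (x / 2) ^ 2 := fun x =>
    div_nonneg (Real.cosh_pos _).le (sq_nonneg _)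
  have hsinh : Tendsto (fun r : ℝ => Real.sinh (r / 2)) atTop atTop := by
    refine tendsto_atTop_mono' atTop ?_ (tendsto_id.atTop_div_const (show (0 : ℝ) < 2 by norm_num))
    filter_upwards [eventually_ge_atTop 0] with x hx
    exact Real.self_le_sinh_iff.2 (div_nonneg hx zero_le_two)
  have hlim : Tendsto (fun r : ℝ => -(2 / Real.sinh (r / 2))) atTop (𝓝 0) := by
    simpa using (hsinh.const_div_atTop 2).neg
  rw [← ofReal_integral_eq_lintegral_ofReal
    (integrableOn_Ioi_deriv_of_nonneg' hderiv (fun x _ => hnonneg x) hlim)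
    (ae_of_all _ hnonneg),
    integral_Ioi_of_hasDerivAt_of_nonneg' hderiv (fun x _ => hnonneg x) hlim]
  simp

lemma lintegral_Ioi_mul_lintegral_Ioc {K G : ℝ → ℝ≥0∞} (hK : Measurable K) (hG : Measurable G) :
    ∫⁻ r in Ioi (0 : ℝ), K r * ∫⁻ s in Ioc 0 r, G s =
      ∫⁻ s in Ioi (0 : ℝ), G s * ∫⁻ r in Ioi s, K r := by
  have hF : Measurable (Function.uncurry fun r s : ℝ => if s ≤ r then K r * G s else 0) :=
    Measurable.ite (measurableSet_le measurable_snd measurable_fst)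
      ((hK.comp measurable_fst).mul (hG.comp measurable_snd)) measurable_const
  have hswap := lintegral_lintegral_swap (μ := volume.restrict (Ioi (0 : ℝ)))
    (ν := volume.restrict (Ioi (0 : ℝ))) hF.aemeasurable
  convert hswap using 1
  · refine lintegral_congr fun r => ?_
    rw [← lintegral_const_mul _ hG, ← Ioi_inter_Iic, inter_comm,
      ← Measure.restrict_restrict measurableSet_Iic, ← lintegral_indicator measurableSet_Iic]
    rfl
  · refine setLIntegral_congr_fun measurableSet_Ioi fun s hs => ?_
    have hs' : Ici s ∩ Ioi 0 = Ici s := inter_eq_left.2 fun x hx =>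
      lt_of_lt_of_le (mem_Ioi.1 hs) (mem_Ici.1 hx)
    rw [setLIntegral_congr Ioi_ae_eq_Ici, ← lintegral_const_mul _ hK, ← hs',
      ← Measure.restrict_restrict measurableSet_Ici, ← lintegral_indicator measurableSet_Ici]
    refine lintegral_congr fun r => ?_
    simp only [indicator, mem_Ici, mul_comm]

lemma sinh_eq_two_mul_sinh_half_mul_cosh_half (r : ℝ) :
    Real.sinh r = 2 * Real.sinh (r / 2) * Real.cosh (r / 2) := by
  rw [← Real.sinh_two_mul]
  congr 1
  ring

lemma hardy_weight_le {p r : ℝ} (hp : 0 ≤ p) (hr : 0 < r) :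
    4 * (2 * Real.sinh (r / 2)) ^ (p - 2) * (2 * Real.sinh (r / 2)) ^ (p - 1) /
      Real.sinh r ^ p * Real.sinh r ≤
        2 ^ p * (Real.cosh (r / 2) / Real.sinh (r / 2) ^ 2) := by
  have hS : 0 < Real.sinh (r / 2) := Real.sinh_pos_iff.2 (by linarith)
  have hSc : Real.sinh (r / 2) ≤ Real.cosh (r / 2) := (Real.sinh_lt_cosh _).le
  rw [sinh_eq_two_mul_sinh_half_mul_cosh_half r]
  generalize Real.sinh (r / 2) = S at *
  generalize Real.cosh (r / 2) = c at *
  have hc : 0 < c := hS.trans_le hSc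
  have key : (2 * S) ^ p * (2 * S) ^ p ≤ 2 ^ p * (2 * S * c) ^ p := by
    rw [← Real.mul_rpow (by positivity) (by positivity),
      ← Real.mul_rpow (by positivity) (by positivity)]
    refine Real.rpow_le_rpow (by positivity) ?_ hp
    nlinarith
  rw [Real.rpow_sub (by positivity), Real.rpow_sub (by positivity), Real.rpow_one,
    Real.rpow_two]
  have hP : 0 < (2 * S * c) ^ p := by positivity
  calc _ = ((2 * S) ^ p * (2 * S) ^ p) / (2 * S * c) ^ p * (c / S ^ 2) := by
        field_simp
        norm_num
    _ ≤ 2 ^ p * (c / S ^ 2) := by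
        gcongr
        rwa [div_le_iff₀ hP]

lemma hardy_pointwise {p r : ℝ} (hp : 2 ≤ p) (hr : 0 < r) {g : ℝ → ℝ≥0∞} (hg : Measurable g) :
    ((∫⁻ s in Ioc 0 r, g s * ENNReal.ofReal (Real.sinh s)) / ENNReal.ofReal (Real.sinh r)) ^ p *
      ENNReal.ofReal (Real.sinh r) ≤
    ENNReal.ofReal (2 ^ p * (Real.cosh (r / 2) / Real.sinh (r / 2) ^ 2)) *
      ∫⁻ s in Ioc 0 r,
        g s ^ p * ENNReal.ofReal (Real.sinh (s / 2) ^ 2 * Real.cosh (s / 2)) := by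
  have hp0 : 0 ≤ p := by linarith
  have hS : 0 < Real.sinh (r / 2) := Real.sinh_pos_iff.2 (by linarith)
  have hsr : 0 < Real.sinh r := Real.sinh_pos_iff.2 hr
  have hcm : Measurable fun s : ℝ => ENNReal.ofReal (Real.cosh (s / 2)) := by fun_prop
  have hfm : Measurable fun s : ℝ => g s * ENNReal.ofReal (2 * Real.sinh (s / 2)) := by fun_prop
  set ν := (volume.restrict (Ioc 0 r)).withDensity fun s => ENNReal.ofReal (Real.cosh (s / 2))
    with hν
  have hT : ∫⁻ s in Ioc 0 r, g s * ENNReal.ofReal (Real.sinh s) =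
      ∫⁻ s, g s * ENNReal.ofReal (2 * Real.sinh (s / 2)) ∂ν := by
    rw [lintegral_withDensity_eq_lintegral_mul _ hcm hfm]
    refine lintegral_congr fun s => ?_
    rw [sinh_eq_two_mul_sinh_half_mul_cosh_half s, ENNReal.ofReal_mul' (Real.cosh_pos _).le,
      Pi.mul_apply]
    ring
  have hmass : ν univ = ENNReal.ofReal (2 * Real.sinh (r / 2)) := by
    rw [hν, withDensity_apply _ MeasurableSet.univ, Measure.restrict_univ,
      lintegral_cosh_half_Ioc hr.le]
  have hpow : ∫⁻ s, (g s * ENNReal.ofReal (2 * Real.sinh (s / 2))) ^ p ∂ν ≤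
      ENNReal.ofReal (4 * (2 * Real.sinh (r / 2)) ^ (p - 2)) * ∫⁻ s in Ioc 0 r,
        g s ^ p * ENNReal.ofReal (Real.sinh (s / 2) ^ 2 * Real.cosh (s / 2)) := by
    rw [lintegral_withDensity_eq_lintegral_mul _ hcm (hfm.pow_const p),
      ← lintegral_const_mul _ (by fun_prop)]
    refine setLIntegral_mono' measurableSet_Ioc fun s hs => ?_
    have hs0 : 0 < Real.sinh (s / 2) := Real.sinh_pos_iff.2 (by linarith [hs.1])
    have hsr' : Real.sinh (s / 2) ≤ Real.sinh (r / 2) :=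
      Real.sinh_le_sinh.2 (by linarith [hs.2])
    have hreal : (2 * Real.sinh (s / 2)) ^ p * Real.cosh (s / 2) ≤
        4 * (2 * Real.sinh (r / 2)) ^ (p - 2) *
          (Real.sinh (s / 2) ^ 2 * Real.cosh (s / 2)) := by
      have h1 : (2 * Real.sinh (s / 2)) ^ p =
          (2 * Real.sinh (s / 2)) ^ (p - 2) * (2 * Real.sinh (s / 2)) ^ 2 := by
        rw [← Real.rpow_two, ← Real.rpow_add (by positivity)]
        congr 1
        ring
      have h2 : (2 * Real.sinh (s / 2)) ^ (p - 2) ≤ (2 * Real.sinh (r / 2)) ^ (p - 2) :=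
        Real.rpow_le_rpow (by positivity) (by linarith) (by linarith)
      have h3 := mul_le_mul_of_nonneg_right h2
        (show 0 ≤ 4 * (Real.sinh (s / 2) ^ 2 * Real.cosh (s / 2)) by positivity)
      rw [h1]
      linarith
    rw [Pi.mul_apply, ENNReal.mul_rpow_of_nonneg _ _ hp0,
      ENNReal.ofReal_rpow_of_pos (by positivity)]
    calc _ = g s ^ p * ENNReal.ofReal ((2 * Real.sinh (s / 2)) ^ p * Real.cosh (s / 2)) := by
          rw [ENNReal.ofReal_mul (by positivity)]
          ring
      _ ≤ g s ^ p * ENNReal.ofReal (4 * (2 * Real.sinh (r / 2)) ^ (p - 2) *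
          (Real.sinh (s / 2) ^ 2 * Real.cosh (s / 2))) := by gcongr
      _ = _ := by
          rw [ENNReal.ofReal_mul (by positivity)]
          ring
  have hHolder := (lintegral_rpow_le_lintegral_rpow_mul ν (by linarith : 1 < p)
    hfm.aemeasurable).trans (mul_le_mul_left hpow _)
  rw [← hT, hmass, ENNReal.ofReal_rpow_of_pos (by positivity)] at hHolder
  generalize (∫⁻ s in Ioc 0 r,
    g s ^ p * ENNReal.ofReal (Real.sinh (s / 2) ^ 2 * Real.cosh (s / 2))) = I at *
  rw [ENNReal.div_rpow_of_nonneg _ _ hp0, ENNReal.ofReal_rpow_of_pos hsr]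
  calc _ ≤ ENNReal.ofReal (4 * (2 * Real.sinh (r / 2)) ^ (p - 2)) * I *
        ENNReal.ofReal ((2 * Real.sinh (r / 2)) ^ (p - 1)) / ENNReal.ofReal (Real.sinh r ^ p) *
          ENNReal.ofReal (Real.sinh r) := by gcongr
    _ = ENNReal.ofReal (4 * (2 * Real.sinh (r / 2)) ^ (p - 2) *
          (2 * Real.sinh (r / 2)) ^ (p - 1) / Real.sinh r ^ p * Real.sinh r) * I := by
        rw [ENNReal.ofReal_mul' hsr.le, ENNReal.ofReal_div_of_pos (by positivity),
          ENNReal.ofReal_mul' (q := (2 * Real.sinh (r / 2)) ^ (p - 1)) (by positivity)]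
        simp only [div_eq_mul_inv]
        ring
    _ ≤ _ := by
        refine mul_le_mul_left (ENNReal.ofReal_le_ofReal ?_) _
        exact hardy_weight_le hp0 hr

/-- Hardy's inequality on the half line with respect to the measure `sinh r dr`. -/
lemma hardy_sinh {p : ℝ} (hp : 2 ≤ p) {g : ℝ → ℝ≥0∞} (hg : Measurable g) :
    ∫⁻ r in Ioi (0 : ℝ), ((∫⁻ s in Ioc 0 r, g s * ENNReal.ofReal (Real.sinh s)) /
        ENNReal.ofReal (Real.sinh r)) ^ p * ENNReal.ofReal (Real.sinh r) ≤
      2 ^ p * ∫⁻ s in Ioi (0 : ℝ), g s ^ p * ENNReal.ofReal (Real.sinh s) := by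
  refine (setLIntegral_mono' measurableSet_Ioi fun r hr => hardy_pointwise hp hr hg).trans
    (le_of_eq ?_)
  rw [lintegral_Ioi_mul_lintegral_Ioc (by fun_prop) (by fun_prop),
    ← lintegral_const_mul _ (by fun_prop)]
  refine setLIntegral_congr_fun measurableSet_Ioi fun s hs => ?_
  have hs0 : 0 < Real.sinh (s / 2) := Real.sinh_pos_iff.2 (by have : 0 < s := hs; linarith)
  simp only [ENNReal.ofReal_mul (show (0 : ℝ) ≤ 2 ^ p by positivity)]
  rw [lintegral_const_mul _ (by fun_prop), lintegral_cosh_half_div_sinh_half_sq_Ioi hs,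
    ← ENNReal.ofReal_rpow_of_pos two_pos, ENNReal.ofReal_ofNat]
  have h : Real.sinh s = Real.sinh (s / 2) ^ 2 * Real.cosh (s / 2) * (2 / Real.sinh (s / 2)) := by
    rw [sinh_eq_two_mul_sinh_half_mul_cosh_half s]
    field_simp
  rw [h, ENNReal.ofReal_mul (p := Real.sinh (s / 2) ^ 2 * Real.cosh (s / 2)) (by positivity)]
  ring

lemma enorm_atheta_le {Q : ℝ → ℝ} {ε : ℝ → ℂ} (hQ : ∀ r, |Q r| ≤ 1) (hε : Measurable ε) (r : ℝ) :
    ‖atheta Q ε r‖ₑ ≤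
      (1 + wLinf ε) * ∫⁻ s in Ioc 0 r, ‖ε s‖ₑ * ENNReal.ofReal (Real.sinh s) := by
  have hsinh : ∀ s ∈ Ioc 0 r, ‖Real.sinh s‖ₑ = ENNReal.ofReal (Real.sinh s) := fun s hs =>
    Real.enorm_of_nonneg (Real.sinh_nonneg_iff.2 hs.1.le)
  have h1 : ‖∫ s in Ioc (0 : ℝ) r, Q s * (ε s).re * Real.sinh s‖ₑ ≤
      ∫⁻ s in Ioc 0 r, ‖ε s‖ₑ * ENNReal.ofReal (Real.sinh s) := by
    refine (enorm_integral_le_lintegral_enorm _).trans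
      (setLIntegral_mono' measurableSet_Ioc fun s hs => ?_)
    rw [enorm_mul, hsinh s hs]
    gcongr
    rw [enorm_le_iff_norm_le, Real.norm_eq_abs, abs_mul]
    exact (mul_le_of_le_one_left (abs_nonneg _) (hQ s)).trans (Complex.abs_re_le_norm _)
  have hM : ∀ᵐ s, s ∈ Ioi (0 : ℝ) → ‖ε s‖ₑ ≤ wLinf ε :=
    (ae_restrict_iff' measurableSet_Ioi).1 (ENNReal.ae_le_essSup _)
  have h2 : ‖∫ s in Ioc (0 : ℝ) r, ‖ε s‖ ^ 2 * Real.sinh s‖ₑ ≤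
      wLinf ε * ∫⁻ s in Ioc 0 r, ‖ε s‖ₑ * ENNReal.ofReal (Real.sinh s) := by
    rw [← lintegral_const_mul _ (by fun_prop)]
    refine (enorm_integral_le_lintegral_enorm _).trans
      (setLIntegral_mono_ae' measurableSet_Ioc ?_)
    filter_upwards [hM] with s hs hsr
    rw [enorm_mul, hsinh s hsr, enorm_pow, enorm_norm, sq, mul_assoc]
    gcongr
    exact hs hsr.1
  have hhalf : ‖(1 / 2 : ℝ)‖ₑ ≤ 1 := by
    rw [← enorm_one (G := ℝ), enorm_le_iff_norm_le]
    norm_num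
  rw [atheta, add_mul, one_mul]
  refine (enorm_sub_le).trans (add_le_add ((enorm_neg _).trans_le h1) ?_)
  rw [enorm_mul]
  exact (mul_le_of_le_one_left zero_le hhalf).trans h2

lemma enorm_atheta_div_sinh_le {Q : ℝ → ℝ} {ε : ℝ → ℂ} (hQ : ∀ r, |Q r| ≤ 1)
    (hε : Measurable ε) {r : ℝ} (hr : 0 < r) :
    ‖atheta Q ε r / Real.sinh r‖ₑ ≤ (1 + wLinf ε) *
      ((∫⁻ s in Ioc 0 r, ‖ε s‖ₑ * ENNReal.ofReal (Real.sinh s)) /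
        ENNReal.ofReal (Real.sinh r)) := by
  have hsr : 0 < Real.sinh r := Real.sinh_pos_iff.2 hr
  rw [div_eq_mul_inv, enorm_mul, enorm_inv hsr.ne', Real.enorm_of_nonneg hsr.le,
    ← div_eq_mul_inv, ← mul_div_assoc]
  gcongr
  exact enorm_atheta_le hQ hε r

lemma wLp_atheta_div_sinh_le {Q : ℝ → ℝ} {ε : ℝ → ℂ} (hQ : ∀ r, |Q r| ≤ 1)
    (hε : Measurable ε) (hM : wLinf ε ≠ ⊤) {p : ℝ} (hp : 2 ≤ p) :
    wLp p (fun r => atheta Q ε r / Real.sinh r) ≤ 2 * ((1 + wLinf ε) * wLp p ε) := by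
  have hp0 : 0 < p := by linarith
  have h : ∫⁻ r in Ioi (0 : ℝ), ‖atheta Q ε r / Real.sinh r‖ₑ ^ p *
      ENNReal.ofReal (Real.sinh r) ≤ (1 + wLinf ε) ^ p *
        (2 ^ p * ∫⁻ s in Ioi (0 : ℝ), ‖ε s‖ₑ ^ p * ENNReal.ofReal (Real.sinh s)) := by
    refine (setLIntegral_mono' measurableSet_Ioi fun r hr =>
      (mul_le_mul_left (ENNReal.rpow_le_rpow (enorm_atheta_div_sinh_le hQ hε hr) hp0.le) _)).trans
      ?_
    simp only [ENNReal.mul_rpow_of_nonneg _ _ hp0.le, mul_assoc]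
    rw [lintegral_const_mul' _ _ (by finiteness)]
    exact mul_le_mul_right (hardy_sinh hp hε.enorm) _
  refine (ENNReal.rpow_le_rpow h (by positivity)).trans (le_of_eq ?_)
  rw [ENNReal.mul_rpow_of_nonneg _ _ (by positivity),
    ENNReal.mul_rpow_of_nonneg _ _ (by positivity),
    ← ENNReal.rpow_mul, ← ENNReal.rpow_mul, mul_one_div_cancel hp0.ne', ENNReal.rpow_one,
    ENNReal.rpow_one, mul_left_comm]
  rfl

lemma wLinf_atheta_div_sinh_le {Q : ℝ → ℝ} {ε : ℝ → ℂ} (hQ : ∀ r, |Q r| ≤ 1)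
    (hε : Measurable ε) :
    wLinf (fun r => atheta Q ε r / Real.sinh r) ≤ (1 + wLinf ε) * wLinf ε := by
  refine essSup_le_of_ae_le _ ((ae_restrict_mem measurableSet_Ioi).mono fun r hr => ?_)
  refine (enorm_atheta_div_sinh_le hQ hε hr).trans (mul_le_mul_right ?_ _)
  have hsr : 0 < Real.sinh r := Real.sinh_pos_iff.2 hr
  have hM : ∀ᵐ s, s ∈ Ioi (0 : ℝ) → ‖ε s‖ₑ ≤ wLinf ε :=
    (ae_restrict_iff' measurableSet_Ioi).1 (ENNReal.ae_le_essSup _)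
  refine ENNReal.div_le_of_le_mul ?_
  calc ∫⁻ s in Ioc 0 r, ‖ε s‖ₑ * ENNReal.ofReal (Real.sinh s)
      ≤ ∫⁻ s in Ioc 0 r, wLinf ε * ENNReal.ofReal (Real.sinh s) := by
        refine setLIntegral_mono_ae' measurableSet_Ioc ?_
        filter_upwards [hM] with s hs hsr
        gcongr
        exact hs hsr.1
    _ = wLinf ε * ENNReal.ofReal (Real.cosh r - 1) := by
        rw [lintegral_const_mul _ (by fun_prop), lintegral_sinh_Ioc (le_of_lt hr)]
    _ ≤ wLinf ε * ENNReal.ofReal (Real.sinh r) := by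
        gcongr
        nlinarith [Real.cosh_sq r, Real.cosh_pos r]

/-- **L^p bound for the linearized magnetic potential:** for `2 ≤ p ≤ ∞`,
`‖a_θ/sinh r‖_{L^p} ≤ C(1 + ‖ε‖_{L^∞})(‖ε‖_{L^∞} + ‖ε‖_{L^p})`. -/
theorem atheta_Lp_bound :
    ∃ C > (0:ℝ), ∀ (Q : ℝ → ℝ) (ε : ℝ → ℂ),
      Measurable Q → (∀ r, |Q r| ≤ 1) → Measurable ε → wLinf ε < ⊤ →
      -- the case 2 ≤ p < ∞
      ((∀ p : ℝ, 2 ≤ p → wLp p ε < ⊤ →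
        wLp p (fun r => atheta Q ε r / Real.sinh r)
          ≤ ENNReal.ofReal C * ((1 + wLinf ε) * (wLinf ε + wLp p ε))) ∧
      -- the case p = ∞
      wLinf (fun r => atheta Q ε r / Real.sinh r)
        ≤ ENNReal.ofReal C * ((1 + wLinf ε) * (wLinf ε + wLinf ε))) := by
  refine ⟨2, two_pos, fun Q ε _ hQ hε hM => ⟨fun p hp _ => ?_, ?_⟩⟩ <;> rw [ENNReal.ofReal_ofNat]
  · refine (wLp_atheta_div_sinh_le hQ hε hM.ne hp).trans ?_
    gcongr
    exact le_add_self
  · refine (wLinf_atheta_div_sinh_le hQ hε).trans ?_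
    refine le_trans ?_ (le_mul_of_one_le_left zero_le one_le_two)
    gcongr
    exact le_add_self

end
end

section
/- L^p bound for the electric potential A₀: for every 2 ≤ p < ∞ there is C > 0 such that ‖A₀‖_{L^p} ≤ C(1 + ‖ε‖_{L^∞})‖ε₁‖_{L^p}, where A₀(r) := (1/2)∫_r^∞ (Q(s)·Re ε₁(s) + Re(ε₁(s)·conj(ε(s)))) ds. -/
/- L^p bound for the electric potential A₀. -/

open MeasureTheory Set Filter
open scoped ENNReal NNReal Topology

noncomputable section

/-- The electric potential
`A₀(r) = (1/2)∫_r^∞ (Q Re ε₁ + Re(ε₁ ε̄)) ds`. -/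
def Azero (Q : ℝ → ℝ) (ε ε₁ : ℝ → ℂ) (r : ℝ) : ℝ :=
  (1/2) * ∫ s in Set.Ioi r, (Q s * (ε₁ s).re + (ε₁ s * (starRingEnd ℂ) (ε s)).re)

/-- A weighted form of Hölder's inequality, with a positive finite weight `g`. -/
theorem lintegral_rpow_le_weighted {α : Type*} [MeasurableSpace α] {μ : Measure α} {p : ℝ}
    (hp : 1 < p) {f g : α → ℝ≥0∞} (hf : AEMeasurable f μ) (hg : AEMeasurable g μ)
    (hg0 : ∀ᵐ x ∂μ, g x ≠ 0) (hgtop : ∀ᵐ x ∂μ, g x ≠ ⊤) :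
    (∫⁻ x, f x ∂μ) ^ p ≤
      (∫⁻ x, f x ^ p * g x ^ (-(p - 1)) ∂μ) * (∫⁻ x, g x ∂μ) ^ (p - 1) := by
  have hpq : p.HolderConjugate p.conjExponent := Real.HolderConjugate.conjExponent hp
  have hp0 : 0 < p := by linarith
  set q := p.conjExponent with hq
  have hq0 : 0 < q := hpq.symm.pos
  have hqp : 1 / q * p = p - 1 := by
    have : p - 1 ≠ 0 := by linarith
    rw [hq, Real.conjExponent]
    field_simp
  have key := ENNReal.lintegral_mul_le_Lp_mul_Lq μ hpq
    (f := fun x => f x * g x ^ (-(1 / q))) (g := fun x => g x ^ (1 / q))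
    (hf.mul (hg.pow_const _)) (hg.pow_const _)
  have h1 : ∫⁻ x, ((fun x => f x * g x ^ (-(1 / q))) * fun x => g x ^ (1 / q)) x ∂μ
      = ∫⁻ x, f x ∂μ := by
    refine lintegral_congr_ae ?_
    filter_upwards [hg0, hgtop] with x h0 ht
    simp only [Pi.mul_apply]
    rw [mul_assoc, ← ENNReal.rpow_add _ _ h0 ht, neg_add_cancel, ENNReal.rpow_zero, mul_one]
  have h2 : ∫⁻ x, (f x * g x ^ (-(1 / q))) ^ p ∂μ
      = ∫⁻ x, f x ^ p * g x ^ (-(p - 1)) ∂μ := by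
    refine lintegral_congr fun x => ?_
    rw [ENNReal.mul_rpow_of_nonneg _ _ hp0.le, ← ENNReal.rpow_mul, neg_mul, hqp]
  have h3 : ∫⁻ x, (g x ^ (1 / q)) ^ q ∂μ = ∫⁻ x, g x ∂μ := by
    refine lintegral_congr fun x => ?_
    rw [← ENNReal.rpow_mul, one_div_mul_cancel hq0.ne', ENNReal.rpow_one]
  rw [h1, h2, h3] at key
  calc (∫⁻ x, f x ∂μ) ^ p ≤ _ := ENNReal.rpow_le_rpow key hp0.le
    _ = _ := by
      rw [ENNReal.mul_rpow_of_nonneg _ _ hp0.le, ← ENNReal.rpow_mul, ← ENNReal.rpow_mul, hqp,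
        one_div_mul_cancel hp0.ne', ENNReal.rpow_one]

/-- Tonelli's theorem on the region `0 < r < s`. -/
theorem lintegral_Ioi_lintegral_Ioi_swap {h F : ℝ → ℝ≥0∞} (hh : Measurable h)
    (hF : Measurable F) :
    ∫⁻ r in Ioi (0 : ℝ), h r * ∫⁻ s in Ioi r, F s
      = ∫⁻ s in Ioi (0 : ℝ), F s * ∫⁻ r in Ioo 0 s, h r := by
  have hmeas : Measurable fun z : ℝ × ℝ =>
      {z : ℝ × ℝ | 0 < z.1 ∧ z.1 < z.2}.indicator (fun z => h z.1 * F z.2) z := by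
    refine Measurable.indicator (by fun_prop) ?_
    exact (measurableSet_lt measurable_const measurable_fst).inter
      (measurableSet_lt measurable_fst measurable_snd)
  have hl : ∫⁻ r in Ioi (0 : ℝ), h r * ∫⁻ s in Ioi r, F s = ∫⁻ r, ∫⁻ s,
      {z : ℝ × ℝ | 0 < z.1 ∧ z.1 < z.2}.indicator (fun z => h z.1 * F z.2) (r, s) := by
    rw [← lintegral_indicator measurableSet_Ioi]
    refine lintegral_congr fun r => ?_
    by_cases hr : 0 < r
    · rw [indicator_of_mem (by exact hr), ← lintegral_const_mul _ hF,
        ← lintegral_indicator measurableSet_Ioi]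
      refine lintegral_congr fun s => ?_
      by_cases hs : r < s <;> simp [indicator, hr, hs]
    · simp [indicator, hr]
  have hr : ∫⁻ s in Ioi (0 : ℝ), F s * ∫⁻ r in Ioo 0 s, h r = ∫⁻ s, ∫⁻ r,
      {z : ℝ × ℝ | 0 < z.1 ∧ z.1 < z.2}.indicator (fun z => h z.1 * F z.2) (r, s) := by
    rw [← lintegral_indicator measurableSet_Ioi]
    refine lintegral_congr fun s => ?_
    by_cases hs : 0 < s
    · rw [indicator_of_mem (by exact hs), ← lintegral_const_mul _ hh,
        ← lintegral_indicator measurableSet_Ioo]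
      refine lintegral_congr fun r => ?_
      by_cases h1 : 0 < r <;> by_cases h2 : r < s <;> simp [indicator, h1, h2, mul_comm]
    · have : ∀ r, ¬ (0 < r ∧ r < s) := fun r h => hs (h.1.trans h.2)
      simp [indicator, hs, this]
  rw [hl, hr]
  exact lintegral_lintegral_swap hmeas.aemeasurable

theorem lintegral_Ioi_cosh_mul_sinh_rpow_le {b r : ℝ} (hb : 0 < b) (hr : 0 < r) :
    ∫⁻ s in Ioi r, ENNReal.ofReal (b * Real.sinh s ^ (-b - 1) * Real.cosh s)
      ≤ ENNReal.ofReal (Real.sinh r ^ (-b)) := by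
  have hpos : ∀ s ∈ Ioi r, 0 ≤ b * Real.sinh s ^ (-b - 1) * Real.cosh s := fun s hs => by
    have := Real.sinh_pos_iff.2 (hr.trans hs)
    have := Real.cosh_pos s
    positivity
  have hderiv : ∀ s ∈ Ici r, HasDerivAt (fun s => -Real.sinh s ^ (-b))
      (b * Real.sinh s ^ (-b - 1) * Real.cosh s) s := fun s hs => by
    have h0 : Real.sinh s ≠ 0 := (Real.sinh_pos_iff.2 (hr.trans_le hs)).ne'
    exact ((Real.hasDerivAt_sinh s).rpow_const (p := -b) (Or.inl h0)).neg.congr_deriv (by ring)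
  have hlim : Tendsto (fun s => -Real.sinh s ^ (-b)) atTop (𝓝 0) := by
    have h1 : Tendsto Real.sinh atTop atTop :=
      tendsto_atTop_mono' _ ((eventually_ge_atTop 0).mono fun s hs => Real.self_le_sinh_iff.2 hs)
        tendsto_id
    simpa using ((tendsto_rpow_neg_atTop hb).comp h1).neg
  have hint := integrableOn_Ioi_deriv_of_nonneg' hderiv hpos hlim
  rw [← ofReal_integral_eq_lintegral_ofReal hint
    ((ae_restrict_iff' measurableSet_Ioi).2 (ae_of_all _ hpos)),
    integral_Ioi_of_hasDerivAt_of_nonneg' hderiv hpos hlim]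
  simp

theorem lintegral_Ioo_sinh_rpow_half_le {s : ℝ} (hs : 0 < s) :
    ∫⁻ r in Ioo 0 s, ENNReal.ofReal (Real.sinh r ^ (1 / 2 : ℝ))
      ≤ ENNReal.ofReal (2 * Real.sinh s ^ (1 / 2 : ℝ)) := by
  have hc : Continuous fun r => Real.sinh r ^ (1 / 2 : ℝ) :=
    Real.continuous_sinh.rpow_const fun _ => Or.inr (by norm_num)
  have hint : IntegrableOn (fun r => Real.sinh r ^ (1 / 2 : ℝ)) (Icc 0 s) :=
    hc.continuousOn.integrableOn_Icc
  have hle : ∫ r in (0)..s, Real.sinh r ^ (1 / 2 : ℝ)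
      ≤ 2 * Real.sinh s ^ (1 / 2 : ℝ) - 2 * Real.sinh 0 ^ (1 / 2 : ℝ) := by
    refine intervalIntegral.integral_le_sub_of_hasDeriv_right_of_le
      (g := fun r => 2 * Real.sinh r ^ (1 / 2 : ℝ))
      (g' := fun r => Real.sinh r ^ (1 / 2 - 1 : ℝ) * Real.cosh r) hs.le
      (hc.const_mul 2 |>.continuousOn) (fun r hr => ?_) hint fun r hr => ?_
    · have h0 : Real.sinh r ≠ 0 := (Real.sinh_pos_iff.2 hr.1).ne'
      refine HasDerivAt.hasDerivWithinAt ?_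
      exact (((Real.hasDerivAt_sinh r).rpow_const (p := 1 / 2) (Or.inl h0)).const_mul 2).congr_deriv
        (by ring)
    · have h0 := Real.sinh_pos_iff.2 hr.1
      calc Real.sinh r ^ (1 / 2 : ℝ) = Real.sinh r ^ (1 / 2 - 1 : ℝ) * Real.sinh r := by
            rw [← Real.rpow_add_one h0.ne']; norm_num
        _ ≤ _ := by
            have := (Real.sinh_lt_cosh r).le
            gcongr
  rw [← ofReal_integral_eq_lintegral_ofReal (hint.mono_set Ioo_subset_Icc_self)
    ((ae_restrict_iff' measurableSet_Ioo).2 (ae_of_all _ fun r hr =>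
      Real.rpow_nonneg (Real.sinh_nonneg_iff.2 hr.1.le) _)), ← integral_Ioc_eq_integral_Ioo,
    ← intervalIntegral.integral_of_le hs.le]
  refine ENNReal.ofReal_le_ofReal (hle.trans ?_)
  simp

/-- A Hardy inequality on the half line with respect to the measure `sinh r dr`. -/
theorem lintegral_hardy_sinh {p : ℝ} (hp : 1 < p) {f : ℝ → ℝ≥0∞} (hf : Measurable f) :
    ∫⁻ r in Ioi (0 : ℝ), (∫⁻ s in Ioi r, f s) ^ p * ENNReal.ofReal (Real.sinh r)
      ≤ ENNReal.ofReal (2 * (2 * (p - 1)) ^ (p - 1)) *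
        ∫⁻ s in Ioi (0 : ℝ), f s ^ p * ENNReal.ofReal (Real.sinh s) := by
  have hp1 : 0 < p - 1 := by linarith
  obtain ⟨b, hbdef⟩ : ∃ b, b = (2 * (p - 1))⁻¹ := ⟨_, rfl⟩
  have hb : 0 < b := by rw [hbdef]; positivity
  have hbp : b * (p - 1) = 1 / 2 := by rw [hbdef]; field_simp
  set g : ℝ → ℝ := fun s => b * Real.sinh s ^ (-b - 1) * Real.cosh s with hg
  have hgm : Measurable g := by
    have := Real.measurable_sinh
    have := Real.measurable_cosh
    fun_prop
  have hgpos : ∀ s, 0 < s → 0 < g s := fun s hs => by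
    have := Real.sinh_pos_iff.2 hs
    have := Real.cosh_pos s
    positivity
  set F : ℝ → ℝ≥0∞ := fun s => f s ^ p * ENNReal.ofReal (g s) ^ (-(p - 1)) with hF
  have hFm : Measurable F := by fun_prop
  have hhm : Measurable fun r => ENNReal.ofReal (Real.sinh r ^ (1 / 2 : ℝ)) := by
    have := Real.measurable_sinh
    fun_prop
  have hholder : ∀ r ∈ Ioi (0 : ℝ), (∫⁻ s in Ioi r, f s) ^ p * ENNReal.ofReal (Real.sinh r)
      ≤ ENNReal.ofReal (Real.sinh r ^ (1 / 2 : ℝ)) * ∫⁻ s in Ioi r, F s := fun r hr => by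
    have hS := Real.sinh_pos_iff.2 hr
    have h1 := lintegral_rpow_le_weighted (μ := volume.restrict (Ioi r)) hp hf.aemeasurable
      hgm.ennreal_ofReal.aemeasurable
      ((ae_restrict_iff' measurableSet_Ioi).2 (ae_of_all _ fun s hs => by
        simpa using hgpos s (lt_trans hr hs)))
      (ae_of_all _ fun s => ENNReal.ofReal_ne_top)
    calc _ ≤ ((∫⁻ s in Ioi r, F s) * ENNReal.ofReal (Real.sinh r ^ (-b)) ^ (p - 1))
          * ENNReal.ofReal (Real.sinh r) := by
          gcongr
          refine h1.trans ?_
          gcongr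
          exact lintegral_Ioi_cosh_mul_sinh_rpow_le hb hr
      _ = _ := by
          rw [ENNReal.ofReal_rpow_of_pos (by positivity), mul_assoc,
            ← ENNReal.ofReal_mul (by positivity), ← Real.rpow_mul hS.le, neg_mul, hbp,
            ← Real.rpow_add_one hS.ne', mul_comm]
          norm_num
  have hweight : ∀ s ∈ Ioi (0 : ℝ), F s * ∫⁻ r in Ioo 0 s,
      ENNReal.ofReal (Real.sinh r ^ (1 / 2 : ℝ))
      ≤ ENNReal.ofReal (2 * (2 * (p - 1)) ^ (p - 1)) *
        (f s ^ p * ENNReal.ofReal (Real.sinh s)) := fun s hs => by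
    have hS := Real.sinh_pos_iff.2 hs
    have hlow : b * Real.sinh s ^ (-b) ≤ g s := by
      calc b * Real.sinh s ^ (-b) = b * Real.sinh s ^ (-b - 1) * Real.sinh s := by
            rw [mul_assoc, ← Real.rpow_add_one hS.ne']; simp
        _ ≤ _ := by
            have := (Real.sinh_lt_cosh s).le
            simp only [hg]
            gcongr
    have hg1 : g s ^ (-(p - 1)) ≤ (2 * (p - 1)) ^ (p - 1) * Real.sinh s ^ (1 / 2 : ℝ) := by
      calc g s ^ (-(p - 1)) ≤ (b * Real.sinh s ^ (-b)) ^ (-(p - 1)) :=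
            Real.rpow_le_rpow_of_nonpos (by positivity) hlow (by linarith)
        _ = _ := by
            rw [Real.mul_rpow hb.le (by positivity), ← Real.rpow_mul hS.le, neg_mul_neg, hbp, hbdef,
              Real.rpow_neg (by positivity), Real.inv_rpow (by positivity), inv_inv]
    calc _ ≤ (f s ^ p * ENNReal.ofReal ((2 * (p - 1)) ^ (p - 1) * Real.sinh s ^ (1 / 2 : ℝ))) *
          ENNReal.ofReal (2 * Real.sinh s ^ (1 / 2 : ℝ)) := by
          simp only [hF]
          rw [ENNReal.ofReal_rpow_of_pos (hgpos s hs)]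
          gcongr
          exact lintegral_Ioo_sinh_rpow_half_le hs
      _ = _ := by
          rw [mul_assoc, mul_left_comm (ENNReal.ofReal (2 * _)),
            ← ENNReal.ofReal_mul (by positivity), ← ENNReal.ofReal_mul (by positivity)]
          congr 2
          have : Real.sinh s ^ (1 / 2 : ℝ) * Real.sinh s ^ (1 / 2 : ℝ) = Real.sinh s := by
            rw [← Real.rpow_add hS]; norm_num
          linear_combination (2 * (2 * (p - 1)) ^ (p - 1)) * this
  calc _ ≤ ∫⁻ r in Ioi (0 : ℝ), ENNReal.ofReal (Real.sinh r ^ (1 / 2 : ℝ)) * ∫⁻ s in Ioi r, F s :=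
        setLIntegral_mono' measurableSet_Ioi hholder
    _ = _ := lintegral_Ioi_lintegral_Ioi_swap hhm hFm
    _ ≤ _ := setLIntegral_mono' measurableSet_Ioi hweight
    _ = _ := lintegral_const_mul' _ _ ENNReal.ofReal_ne_top

theorem enorm_Azero_le {Q : ℝ → ℝ} {ε ε₁ : ℝ → ℂ} (hQ : ∀ r ∈ Ioi (0 : ℝ), |Q r| ≤ 1)
    (hε₁ : Measurable ε₁) {r : ℝ} (hr : 0 < r) :
    ‖Azero Q ε ε₁ r‖ₑ ≤ (1 + wLinf ε) * ∫⁻ s in Ioi r, ‖ε₁ s‖ₑ := by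
  have hε : ∀ᵐ s ∂volume.restrict (Ioi r), ‖ε s‖ₑ ≤ wLinf ε :=
    ae_restrict_of_ae_restrict_of_subset (Ioi_subset_Ioi hr.le)
      (ENNReal.ae_le_essSup fun s => ‖ε s‖ₑ)
  have hhalf : ‖(1 / 2 : ℝ)‖ₑ ≤ 1 := by
    rw [Real.enorm_eq_ofReal (by norm_num), ENNReal.ofReal_le_one]
    norm_num
  calc ‖Azero Q ε ε₁ r‖ₑ
      ≤ 1 * ∫⁻ s in Ioi r, ‖Q s * (ε₁ s).re + (ε₁ s * (starRingEnd ℂ) (ε s)).re‖ₑ := by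
        rw [Azero, enorm_mul]
        exact mul_le_mul' hhalf (enorm_integral_le_lintegral_enorm _)
    _ ≤ ∫⁻ s in Ioi r, (1 + wLinf ε) * ‖ε₁ s‖ₑ := by
        rw [one_mul]
        refine lintegral_mono_ae ?_
        filter_upwards [hε, ae_restrict_mem measurableSet_Ioi] with s hs hrs
        have hQs : ‖Q s‖ₑ ≤ 1 := by
          rw [Real.enorm_eq_ofReal_abs, ENNReal.ofReal_le_one]
          exact hQ s (hr.trans hrs)
        have hre : ∀ z : ℂ, ‖z.re‖ₑ ≤ ‖z‖ₑ := fun z =>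
          enorm_le_iff_norm_le.2 (Complex.abs_re_le_norm z)
        have hconj : ‖(starRingEnd ℂ) (ε s)‖ₑ = ‖ε s‖ₑ := by
          rw [← ofReal_norm, ← ofReal_norm, Complex.norm_conj]
        refine (enorm_add_le _ _).trans ?_
        rw [add_mul]
        gcongr
        · rw [enorm_mul]
          exact mul_le_mul' hQs (hre _)
        · refine (hre _).trans ?_
          rw [enorm_mul, hconj, mul_comm]
          gcongr
    _ = _ := lintegral_const_mul _ hε₁.enorm

/-- **L^p bound for the electric potential `A₀`:** for every `2 ≤ p < ∞`,
`‖A₀‖_{L^p} ≤ C(1 + ‖ε‖_{L^∞})‖ε₁‖_{L^p}`. -/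
theorem Azero_Lp_bound
    (m : ℕ) (hm : 1 ≤ m) (C_Q : ℝ) (p : ℝ) (hp : 2 ≤ p) :
    ∃ C > (0:ℝ), ∀ (Q : ℝ → ℝ) (ε ε₁ : ℝ → ℂ),
      Measurable Q →
      (∀ r ∈ Set.Ioi (0:ℝ), 0 ≤ Q r ∧ Q r ≤ min (C_Q * r ^ m) 1) →
      Measurable ε → Measurable ε₁ →
      wLinf ε < ⊤ → wLp p ε₁ < ⊤ →
      -- absolute convergence of the integral defining A₀
      (∀ r ∈ Set.Ioi (0:ℝ),
        IntegrableOn (fun s => Q s * (ε₁ s).re + (ε₁ s * (starRingEnd ℂ) (ε s)).re)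
          (Set.Ioi r)) →
      wLp p (fun r => Azero Q ε ε₁ r)
        ≤ ENNReal.ofReal C * ((1 + wLinf ε) * wLp p ε₁) := by
  have hp0 : 0 < p := by linarith
  have hp1 : 0 < p - 1 := by linarith
  set K : ℝ := 2 * (2 * (p - 1)) ^ (p - 1) with hK
  have hKpos : 0 < K := by positivity
  refine ⟨K ^ (1 / p), by positivity, fun Q ε ε₁ _ hQ _ hε₁ hfin _ _ => ?_⟩
  have hQ1 : ∀ r ∈ Ioi (0 : ℝ), |Q r| ≤ 1 := fun r hr => by
    rw [abs_of_nonneg (hQ r hr).1]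
    exact (hQ r hr).2.trans (min_le_right _ _)
  have hmain : ∫⁻ r in Ioi (0 : ℝ), ‖Azero Q ε ε₁ r‖ₑ ^ p * ENNReal.ofReal (Real.sinh r)
      ≤ (1 + wLinf ε) ^ p * (ENNReal.ofReal K *
        ∫⁻ s in Ioi (0 : ℝ), ‖ε₁ s‖ₑ ^ p * ENNReal.ofReal (Real.sinh s)) := by
    calc _ ≤ ∫⁻ r in Ioi (0 : ℝ), (1 + wLinf ε) ^ p *
          ((∫⁻ s in Ioi r, ‖ε₁ s‖ₑ) ^ p * ENNReal.ofReal (Real.sinh r)) := by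
          refine setLIntegral_mono' measurableSet_Ioi fun r hr => ?_
          rw [← mul_assoc, ← ENNReal.mul_rpow_of_nonneg _ _ hp0.le]
          gcongr
          exact enorm_Azero_le hQ1 hε₁ hr
      _ = (1 + wLinf ε) ^ p * ∫⁻ r in Ioi (0 : ℝ),
          (∫⁻ s in Ioi r, ‖ε₁ s‖ₑ) ^ p * ENNReal.ofReal (Real.sinh r) :=
          lintegral_const_mul' _ _ (ENNReal.rpow_ne_top_of_nonneg hp0.le
            (ENNReal.add_ne_top.2 ⟨ENNReal.one_ne_top, hfin.ne⟩))
      _ ≤ _ := by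
          gcongr
          exact lintegral_hardy_sinh (by linarith) hε₁.enorm
  have h1p : 0 ≤ 1 / p := by positivity
  refine (ENNReal.rpow_le_rpow hmain h1p).trans_eq ?_
  rw [ENNReal.mul_rpow_of_nonneg _ _ h1p, ENNReal.mul_rpow_of_nonneg _ _ h1p, ← ENNReal.rpow_mul,
    mul_one_div_cancel hp0.ne', ENNReal.rpow_one, ENNReal.ofReal_rpow_of_pos hKpos, mul_left_comm]
  rfl

end
end

section
/- Sobolev-type embedding adapted to H¹_m: there is C > 0 such that for every ε ∈ C¹((0,∞),ℂ) with lim_{r→0⁺} ε(r) = 0, with ‖∂_r ε‖_{L²}, ‖ε/sinh(r)‖_{L²}, ‖ε‖_{L²} finite, one has (i) sup_{r>0} |ε(r)|² ≤ 2‖ε/sinh(r)‖_{L²}·‖∂_r ε‖_{L²} and (ii) ‖ε‖_{L²} ≤ 2‖∂_r ε‖_{L²}; consequently ‖ε‖_{L²} + ‖ε‖_{L^∞} ≤ C·‖ε‖_{H¹_m}. -/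
/- Sobolev-type embedding adapted to the equivariant space H¹_m on the
hyperbolic plane. -/

open MeasureTheory Set Filter
open scoped ENNReal NNReal Topology

noncomputable section

/-- Weighted `H¹_m` norm: `‖∂_r F‖_{L²} + ‖F / sinh r‖_{L²}`. -/
def wH1m (F : ℝ → ℂ) : ℝ≥0∞ :=
  wLp 2 (deriv F) + wLp 2 (fun r => F r / (Real.sinh r : ℂ))

theorem lintegral_sinh_mul_le_wLp_mul_wLp {F G : ℝ → ℂ} (hF : ContinuousOn F (Ioi 0))
    (hG : ContinuousOn G (Ioi 0)) :
    ∫⁻ r in Ioi (0:ℝ), ‖F r‖ₑ * ‖G r‖ₑ * ENNReal.ofReal (Real.sinh r) ≤ wLp 2 F * wLp 2 G := by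
  have meas : ∀ H : ℝ → ℂ, ContinuousOn H (Ioi 0) →
      AEMeasurable (fun r => ‖H r‖ₑ * (ENNReal.ofReal (Real.sinh r)) ^ (1/2:ℝ))
        (volume.restrict (Ioi 0)) := by
    intro H hH
    have h1 : AEMeasurable H (volume.restrict (Ioi 0)) := hH.aemeasurable measurableSet_Ioi
    have h2 : Measurable fun r : ℝ => (ENNReal.ofReal (Real.sinh r)) ^ (1/2:ℝ) :=
      (Real.measurable_sinh.ennreal_ofReal).pow_const _
    exact h1.enorm.mul h2.aemeasurable
  have key := ENNReal.lintegral_mul_le_Lp_mul_Lq (volume.restrict (Ioi (0:ℝ)))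
    Real.HolderConjugate.two_two (meas F hF) (meas G hG)
  have sq : ∀ x : ℝ≥0∞, (x ^ (1/2:ℝ)) ^ (2:ℝ) = x := fun x => by
    rw [← ENNReal.rpow_mul]; norm_num
  have sq' : ∀ x : ℝ≥0∞, x ^ (1/2:ℝ) * x ^ (1/2:ℝ) = x := fun x => by
    rw [← pow_two, ← ENNReal.rpow_two, sq]
  simp only [Pi.mul_apply, ENNReal.mul_rpow_of_nonneg _ _ (zero_le_two : (0:ℝ) ≤ 2), sq] at key
  refine le_trans (le_of_eq ?_) key
  refine lintegral_congr fun r => ?_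
  conv_lhs => rw [← sq' (ENNReal.ofReal (Real.sinh r))]
  ring

theorem ofReal_intervalIntegral_eq_setLIntegral {f : ℝ → ℝ} {a b : ℝ} (hab : a ≤ b)
    (hf : ContinuousOn f (Icc a b)) (h0 : ∀ x ∈ Icc a b, 0 ≤ f x) :
    ENNReal.ofReal (∫ x in a..b, f x) = ∫⁻ x in Ioc a b, ENNReal.ofReal (f x) := by
  rw [intervalIntegral.integral_of_le hab]
  refine ofReal_integral_eq_lintegral_ofReal ?_ ?_
  · exact (hf.integrableOn_Icc).mono_set Ioc_subset_Icc_self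
  · exact (ae_restrict_iff' measurableSet_Ioc).2
      (Eventually.of_forall fun x hx => h0 x (Ioc_subset_Icc_self hx))

theorem frequently_atTop_lt_of_setLIntegral_lt_top {f : ℝ → ℝ≥0∞} {a : ℝ}
    (hf : ∫⁻ x in Ioi a, f x < ⊤) {δ : ℝ≥0∞} (hδ : δ ≠ 0) :
    ∃ᶠ x in atTop, f x < δ := by
  intro h
  obtain ⟨M, hM⟩ := eventually_atTop.1 h
  have h1 : ∫⁻ _ in Ioi (max a M), δ ≤ ∫⁻ x in Ioi a, f x :=
    (setLIntegral_mono' measurableSet_Ioi fun x hx =>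
      not_lt.1 (hM x ((le_max_right _ _).trans (le_of_lt hx)))).trans
      (lintegral_mono_set (Ioi_subset_Ioi (le_max_left _ _)))
  rw [setLIntegral_const, Real.volume_Ioi, ENNReal.mul_top hδ] at h1
  exact absurd (h1.trans_lt hf) (lt_irrefl _)

theorem integral_deriv_normSq_mul {ε : ℝ → ℂ} (hε : ContDiffOn ℝ 1 ε (Ioi 0))
    {w w' : ℝ → ℝ} (hw : ∀ x, HasDerivAt w (w' x) x)
    (hw' : Continuous w') {a b : ℝ} (ha : 0 < a) (hab : a ≤ b) :
    ∫ x in a..b, (2 * inner ℝ (ε x) (deriv ε x) * w x + ‖ε x‖ ^ 2 * w' x) =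
      ‖ε b‖ ^ 2 * w b - ‖ε a‖ ^ 2 * w a := by
  have hsub : uIcc a b ⊆ Ioi 0 := by
    rw [uIcc_of_le hab]; exact fun x hx => ha.trans_le hx.1
  have hd : ContinuousOn (deriv ε) (Ioi 0) := hε.continuousOn_deriv_of_isOpen isOpen_Ioi le_rfl
  have hwc : Continuous w := continuous_iff_continuousAt.2 fun x => (hw x).continuousAt
  refine intervalIntegral.integral_eq_sub_of_hasDerivAt (f := fun x => ‖ε x‖ ^ 2 * w x)
    (fun x hx => ?_) ?_
  · have h1 : HasDerivAt ε (deriv ε x) x :=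
      ((hε.differentiableOn one_ne_zero).differentiableAt
        (isOpen_Ioi.mem_nhds (hsub hx))).hasDerivAt
    exact h1.norm_sq.mul (hw x)
  · refine ContinuousOn.intervalIntegrable ?_
    have e := hε.continuousOn.mono hsub
    have d := hd.mono hsub
    exact ((continuousOn_const.mul (e.inner d)).mul hwc.continuousOn).add
      ((e.norm.pow 2).mul hw'.continuousOn)

theorem ofReal_intervalIntegral_norm_mul_deriv_le {ε : ℝ → ℂ} (hε : ContDiffOn ℝ 1 ε (Ioi 0))
    {w : ℝ → ℝ} (hw : Continuous w) (hw0 : ∀ x, 0 < x → 0 ≤ w x) {a b : ℝ} (ha : 0 < a)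
    (hab : a ≤ b) :
    ENNReal.ofReal (∫ x in a..b, ‖ε x‖ * ‖deriv ε x‖ * w x) ≤
      ∫⁻ r in Ioi (0:ℝ), ‖ε r‖ₑ * ‖deriv ε r‖ₑ * ENNReal.ofReal (w r) := by
  have hsub : Icc a b ⊆ Ioi 0 := fun x hx => ha.trans_le hx.1
  have hd : ContinuousOn (deriv ε) (Ioi 0) := hε.continuousOn_deriv_of_isOpen isOpen_Ioi le_rfl
  rw [ofReal_intervalIntegral_eq_setLIntegral (f := fun x => ‖ε x‖ * ‖deriv ε x‖ * w x) hab
    (((hε.continuousOn.norm.mul hd.norm).mul hw.continuousOn).mono hsub)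
    fun x hx => mul_nonneg (by positivity) (hw0 x (hsub hx))]
  refine (lintegral_mono_set (Ioc_subset_Icc_self.trans hsub)).trans (le_of_eq ?_)
  refine lintegral_congr fun x => ?_
  rw [ENNReal.ofReal_mul (by positivity), ENNReal.ofReal_mul (by positivity), ofReal_norm,
    ofReal_norm]

theorem enorm_sq_le_add_lintegral {ε : ℝ → ℂ} (hε : ContDiffOn ℝ 1 ε (Ioi 0)) {a b : ℝ}
    (ha : 0 < a) (hab : a ≤ b) :
    ‖ε b‖ₑ ^ 2 ≤ ‖ε a‖ₑ ^ 2 + 2 * ∫⁻ r in Ioi (0:ℝ), ‖ε r‖ₑ * ‖deriv ε r‖ₑ := by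
  have hsub : uIcc a b ⊆ Ioi 0 := by
    rw [uIcc_of_le hab]; exact fun x hx => ha.trans_le hx.1
  have e := hε.continuousOn.mono hsub
  have d := (hε.continuousOn_deriv_of_isOpen isOpen_Ioi le_rfl).mono hsub
  have h1 := integral_deriv_normSq_mul hε (w := fun _ => 1) (w' := fun _ => 0)
    (fun x => hasDerivAt_const x _) continuous_const ha hab
  have h2 := ofReal_intervalIntegral_norm_mul_deriv_le hε (w := fun _ => 1) continuous_const
    (fun _ _ => zero_le_one) ha hab
  simp only [mul_one, mul_zero, add_zero, ENNReal.ofReal_one] at h1 h2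
  have h3 : ∫ x in a..b, 2 * inner ℝ (ε x) (deriv ε x) ≤
      ∫ x in a..b, 2 * (‖ε x‖ * ‖deriv ε x‖) :=
    intervalIntegral.integral_mono_on hab
      (continuousOn_const.mul (e.inner d)).intervalIntegrable
      (continuousOn_const.mul (e.norm.mul d.norm)).intervalIntegrable
      fun x _ => by gcongr; exact real_inner_le_norm _ _
  rw [h1, intervalIntegral.integral_const_mul] at h3
  have hI : 0 ≤ ∫ x in a..b, ‖ε x‖ * ‖deriv ε x‖ :=
    intervalIntegral.integral_nonneg hab fun x _ => by positivity
  calc ‖ε b‖ₑ ^ 2 = ENNReal.ofReal (‖ε b‖ ^ 2) := by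
        rw [ENNReal.ofReal_pow (norm_nonneg _), ofReal_norm]
    _ ≤ ENNReal.ofReal (‖ε a‖ ^ 2 + 2 * ∫ x in a..b, ‖ε x‖ * ‖deriv ε x‖) :=
        ENNReal.ofReal_le_ofReal (by linarith)
    _ = ‖ε a‖ₑ ^ 2 + 2 * ENNReal.ofReal (∫ x in a..b, ‖ε x‖ * ‖deriv ε x‖) := by
        rw [ENNReal.ofReal_add (by positivity) (by positivity),
          ENNReal.ofReal_pow (norm_nonneg _), ofReal_norm, ENNReal.ofReal_mul zero_le_two,
          ENNReal.ofReal_ofNat]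
    _ ≤ _ := by gcongr

theorem cosh_sub_one_le_sinh {x : ℝ} (hx : 0 ≤ x) : Real.cosh x - 1 ≤ Real.sinh x := by
  have h1 := Real.cosh_sub_sinh x
  have h2 : Real.exp (-x) ≤ 1 := Real.exp_le_one_iff.2 (by linarith)
  linarith

theorem setLIntegral_enorm_sq_mul_sinh_le {ε : ℝ → ℂ} (hε : ContDiffOn ℝ 1 ε (Ioi 0))
    {a b : ℝ} (ha : 0 < a) (hab : a ≤ b) :
    ∫⁻ r in Ioc a b, ‖ε r‖ₑ ^ 2 * ENNReal.ofReal (Real.sinh r) ≤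
      ‖ε b‖ₑ ^ 2 * ENNReal.ofReal (Real.sinh b) +
        2 * ∫⁻ r in Ioi (0:ℝ), ‖ε r‖ₑ * ‖deriv ε r‖ₑ * ENNReal.ofReal (Real.sinh r) := by
  have hsub' : Icc a b ⊆ Ioi 0 := fun x hx => ha.trans_le hx.1
  have hsub : uIcc a b ⊆ Ioi 0 := by rwa [uIcc_of_le hab]
  have e := hε.continuousOn.mono hsub
  have d := (hε.continuousOn_deriv_of_isOpen isOpen_Ioi le_rfl).mono hsub
  have c : ContinuousOn (fun x => Real.cosh x - 1) (uIcc a b) :=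
    (Real.continuous_cosh.sub continuous_const).continuousOn
  have s : ContinuousOn Real.sinh (uIcc a b) := Real.continuous_sinh.continuousOn
  have hs0 : ∀ x, 0 < x → 0 ≤ Real.sinh x := fun x hx => Real.sinh_nonneg_iff.2 hx.le
  have h1 := integral_deriv_normSq_mul hε (w := fun x => Real.cosh x - 1) (w' := Real.sinh)
    (fun x => (Real.hasDerivAt_cosh x).sub_const 1) Real.continuous_sinh ha hab
  have h2 := ofReal_intervalIntegral_norm_mul_deriv_le hε Real.continuous_sinh hs0 ha hab
  have i1 : IntervalIntegrable (fun x => 2 * (‖ε x‖ * ‖deriv ε x‖ * Real.sinh x)) volume a b :=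
    (continuousOn_const.mul ((e.norm.mul d.norm).mul s)).intervalIntegrable
  have i2 : IntervalIntegrable (fun x => 2 * inner ℝ (ε x) (deriv ε x) * (Real.cosh x - 1) +
      ‖ε x‖ ^ 2 * Real.sinh x) volume a b :=
    (((continuousOn_const.mul (e.inner d)).mul c).add ((e.norm.pow 2).mul s)).intervalIntegrable
  have i3 : IntervalIntegrable (fun x => ‖ε x‖ ^ 2 * Real.sinh x) volume a b :=
    ((e.norm.pow 2).mul s).intervalIntegrable
  have h3 : ∫ x in a..b, ‖ε x‖ ^ 2 * Real.sinh x ≤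
      ∫ x in a..b, ((2 * inner ℝ (ε x) (deriv ε x) * (Real.cosh x - 1) +
        ‖ε x‖ ^ 2 * Real.sinh x) + 2 * (‖ε x‖ * ‖deriv ε x‖ * Real.sinh x)) := by
    refine intervalIntegral.integral_mono_on hab i3 (i2.add i1) fun x hx => ?_
    have p1 : 0 ≤ Real.cosh x - 1 := by linarith [Real.one_le_cosh x]
    have p2 := cosh_sub_one_le_sinh (hsub' hx).le
    have p3 := (abs_le.1 (abs_real_inner_le_norm (ε x) (deriv ε x))).1
    have p4 : 0 ≤ ‖ε x‖ * ‖deriv ε x‖ := by positivity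
    nlinarith [mul_nonneg p1 (sub_nonneg.2 p3), mul_nonneg p4 (sub_nonneg.2 p2)]
  rw [intervalIntegral.integral_add i2 i1, h1, intervalIntegral.integral_const_mul] at h3
  have hb : ‖ε b‖ ^ 2 * (Real.cosh b - 1) ≤ ‖ε b‖ ^ 2 * Real.sinh b := by
    gcongr; exact cosh_sub_one_le_sinh (ha.le.trans hab)
  have ha' : 0 ≤ ‖ε a‖ ^ 2 * (Real.cosh a - 1) :=
    mul_nonneg (by positivity) (by linarith [Real.one_le_cosh a])
  have hI : 0 ≤ ∫ x in a..b, ‖ε x‖ * ‖deriv ε x‖ * Real.sinh x :=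
    intervalIntegral.integral_nonneg hab fun x hx =>
      mul_nonneg (by positivity) (hs0 x (hsub' hx))
  have hsb := hs0 b (ha.trans_le hab)
  have hconv : ∀ x, ENNReal.ofReal (‖ε x‖ ^ 2 * Real.sinh x) =
      ‖ε x‖ₑ ^ 2 * ENNReal.ofReal (Real.sinh x) := fun x => by
    rw [ENNReal.ofReal_mul (by positivity), ENNReal.ofReal_pow (norm_nonneg _), ofReal_norm]
  calc ∫⁻ r in Ioc a b, ‖ε r‖ₑ ^ 2 * ENNReal.ofReal (Real.sinh r)
      = ENNReal.ofReal (∫ x in a..b, ‖ε x‖ ^ 2 * Real.sinh x) := by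
        rw [ofReal_intervalIntegral_eq_setLIntegral hab
          (by rw [← uIcc_of_le hab]; exact (e.norm.pow 2).mul s)
          fun x hx => mul_nonneg (by positivity) (hs0 x (hsub' hx))]
        simp only [hconv]
    _ ≤ ENNReal.ofReal (‖ε b‖ ^ 2 * Real.sinh b +
          2 * ∫ x in a..b, ‖ε x‖ * ‖deriv ε x‖ * Real.sinh x) :=
        ENNReal.ofReal_le_ofReal (by linarith)
    _ = ‖ε b‖ₑ ^ 2 * ENNReal.ofReal (Real.sinh b) +
          2 * ENNReal.ofReal (∫ x in a..b, ‖ε x‖ * ‖deriv ε x‖ * Real.sinh x) := by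
        rw [ENNReal.ofReal_add (by positivity) (by positivity), hconv,
          ENNReal.ofReal_mul zero_le_two, ENNReal.ofReal_ofNat]
    _ ≤ _ := by gcongr

theorem wLp_two_mul_self {E : Type*} [NNNorm E] (F : ℝ → E) :
    wLp 2 F * wLp 2 F =
      ∫⁻ r in Ioi (0:ℝ), (‖F r‖₊ : ℝ≥0∞) ^ 2 * ENNReal.ofReal (Real.sinh r) := by
  rw [← pow_two, ← ENNReal.rpow_two, wLp, ← ENNReal.rpow_mul]
  norm_num

theorem wLp_two_le_two_mul_wLp_deriv {ε : ℝ → ℂ} (hε : ContDiffOn ℝ 1 ε (Ioi 0))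
    (hfin : wLp 2 ε < ⊤) : wLp 2 ε ≤ 2 * wLp 2 (deriv ε) := by
  have hd : ContinuousOn (deriv ε) (Ioi 0) := hε.continuousOn_deriv_of_isOpen isOpen_Ioi le_rfl
  have hsq : wLp 2 ε * wLp 2 ε =
      ∫⁻ r in Ioi (0:ℝ), ‖ε r‖ₑ ^ 2 * ENNReal.ofReal (Real.sinh r) := wLp_two_mul_self ε
  have hCS := lintegral_sinh_mul_le_wLp_mul_wLp hε.continuousOn hd
  have hfin' : ∫⁻ r in Ioi (0:ℝ), ‖ε r‖ₑ ^ 2 * ENNReal.ofReal (Real.sinh r) < ⊤ :=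
    hsq ▸ ENNReal.mul_lt_top hfin hfin
  have bound : ∀ a b : ℝ, 0 < a → ∫⁻ r in Ioc a b, ‖ε r‖ₑ ^ 2 * ENNReal.ofReal (Real.sinh r) ≤
      2 * (wLp 2 ε * wLp 2 (deriv ε)) := by
    intro a b ha
    refine ENNReal.le_of_forall_pos_le_add fun δ hδ _ => ?_
    obtain ⟨R, hR, hRab⟩ := ((frequently_atTop_lt_of_setLIntegral_lt_top hfin'
      (ENNReal.coe_ne_zero.2 hδ.ne')).and_eventually (eventually_ge_atTop (max a b))).exists
    calc _ ≤ ∫⁻ r in Ioc a R, ‖ε r‖ₑ ^ 2 * ENNReal.ofReal (Real.sinh r) :=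
          lintegral_mono_set (Ioc_subset_Ioc_right ((le_max_right _ _).trans hRab))
      _ ≤ _ := setLIntegral_enorm_sq_mul_sinh_le hε ha ((le_max_left _ _).trans hRab)
      _ ≤ δ + 2 * (wLp 2 ε * wLp 2 (deriv ε)) := by gcongr
      _ = _ := add_comm _ _
  have hU : Ioi (0:ℝ) = ⋃ n : ℕ, Ioc ((n + 1 : ℝ)⁻¹) n := by
    ext x
    simp only [mem_Ioi, mem_iUnion, mem_Ioc]
    constructor
    · intro hx
      obtain ⟨n, hn⟩ := exists_nat_ge (max x x⁻¹)
      refine ⟨n, ?_, (le_max_left _ _).trans hn⟩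
      have := (le_max_right _ _).trans hn
      exact inv_lt_of_inv_lt₀ hx (by linarith)
    · rintro ⟨n, hn, -⟩
      exact lt_trans (by positivity) hn
  have hmono : Monotone fun n : ℕ => Ioc ((n + 1 : ℝ)⁻¹) n := fun m n hmn => by
    have : (m : ℝ) ≤ n := by exact_mod_cast hmn
    exact Ioc_subset_Ioc (by gcongr) this
  have hle : wLp 2 ε * wLp 2 ε ≤ wLp 2 ε * (2 * wLp 2 (deriv ε)) := by
    rw [hsq, hU, setLIntegral_iUnion_of_directed _ hmono.directed_le, mul_left_comm]
    exact iSup_le fun n => bound _ _ (by positivity)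
  rcases eq_or_ne (wLp 2 ε) 0 with h0 | h0
  · rw [h0]; exact zero_le
  · exact (ENNReal.mul_le_mul_iff_right h0 hfin.ne).1 hle

theorem enorm_sq_le_wLp_mul_wLp {ε : ℝ → ℂ} (hε : ContDiffOn ℝ 1 ε (Ioi 0))
    (h0 : Tendsto ε (𝓝[>] (0:ℝ)) (𝓝 0)) {r : ℝ} (hr : 0 < r) :
    ‖ε r‖ₑ ^ 2 ≤ 2 * (wLp 2 (fun r => ε r / (Real.sinh r : ℂ)) * wLp 2 (deriv ε)) := by
  have hd : ContinuousOn (deriv ε) (Ioi 0) := hε.continuousOn_deriv_of_isOpen isOpen_Ioi le_rfl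
  have hpos : ∀ x ∈ Ioi (0:ℝ), 0 < Real.sinh x := fun x hx => Real.sinh_pos_iff.2 hx
  have hq : ContinuousOn (fun r => ε r / (Real.sinh r : ℂ)) (Ioi 0) :=
    hε.continuousOn.div (Complex.continuous_ofReal.comp Real.continuous_sinh).continuousOn
      fun x hx => Complex.ofReal_ne_zero.2 (hpos x hx).ne'
  have hCS := lintegral_sinh_mul_le_wLp_mul_wLp hq hd
  have heq : ∫⁻ x in Ioi (0:ℝ), ‖ε x‖ₑ * ‖deriv ε x‖ₑ =
      ∫⁻ x in Ioi (0:ℝ), ‖ε x / (Real.sinh x : ℂ)‖ₑ * ‖deriv ε x‖ₑ *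
        ENNReal.ofReal (Real.sinh x) := by
    refine setLIntegral_congr_fun measurableSet_Ioi fun x hx => ?_
    have hs : ENNReal.ofReal (Real.sinh x) = ‖(Real.sinh x : ℂ)‖ₑ := by
      rw [← ofReal_norm, Complex.norm_of_nonneg (hpos x hx).le]
    change ‖ε x‖ₑ * ‖deriv ε x‖ₑ = _
    rw [hs, mul_right_comm, ← enorm_mul (ε x / (Real.sinh x : ℂ)),
      div_mul_cancel₀ _ (Complex.ofReal_ne_zero.2 (hpos x hx).ne')]
  have hlim : Tendsto (fun a => ‖ε a‖ₑ ^ 2 +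
      2 * (wLp 2 (fun r => ε r / (Real.sinh r : ℂ)) * wLp 2 (deriv ε))) (𝓝[>] (0:ℝ))
      (𝓝 (0 + 2 * (wLp 2 (fun r => ε r / (Real.sinh r : ℂ)) * wLp 2 (deriv ε)))) := by
    refine Tendsto.add ?_ tendsto_const_nhds
    have := ENNReal.Tendsto.pow (n := 2) h0.enorm
    simpa using this
  rw [zero_add] at hlim
  refine ge_of_tendsto hlim ?_
  filter_upwards [Ioo_mem_nhdsGT hr] with a ha
  refine (enorm_sq_le_add_lintegral hε ha.1 ha.2.le).trans ?_
  rw [heq]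
  gcongr

/-- **Sobolev-type embedding adapted to `H¹_m`:** for `ε ∈ C¹((0,∞))` vanishing at the
origin, `sup |ε|² ≤ 2‖ε/sinh r‖_{L²}‖∂_r ε‖_{L²}` and `‖ε‖_{L²} ≤ 2‖∂_r ε‖_{L²}`;
consequently `‖ε‖_{L²} + ‖ε‖_{L^∞} ≤ C‖ε‖_{H¹_m}`. -/
theorem sobolev_embedding_H1m :
    ∃ C > (0:ℝ), ∀ ε : ℝ → ℂ,
      ContDiffOn ℝ 1 ε (Set.Ioi 0) →
      Tendsto ε (𝓝[>] (0:ℝ)) (𝓝 0) →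
      wLp 2 (deriv ε) < ⊤ →
      wLp 2 (fun r => ε r / (Real.sinh r : ℂ)) < ⊤ →
      wLp 2 ε < ⊤ →
      -- (i)
      ((⨆ r ∈ Set.Ioi (0:ℝ), (‖ε r‖₊ : ℝ≥0∞) ^ (2:ℝ))
          ≤ 2 * (wLp 2 (fun r => ε r / (Real.sinh r : ℂ)) * wLp 2 (deriv ε)) ∧
      -- (ii)
      wLp 2 ε ≤ 2 * wLp 2 (deriv ε) ∧
      -- consequence
      wLp 2 ε + (⨆ r ∈ Set.Ioi (0:ℝ), (‖ε r‖₊ : ℝ≥0∞))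
          ≤ ENNReal.ofReal C * wH1m ε) := by
  refine ⟨3, by norm_num, fun ε hε h0 _ _ hfin => ?_⟩
  have hi := fun r (hr : r ∈ Ioi (0:ℝ)) => enorm_sq_le_wLp_mul_wLp hε h0 hr
  have hii := wLp_two_le_two_mul_wLp_deriv hε hfin
  refine ⟨iSup₂_le fun r hr => ?_, hii, ?_⟩
  · rw [ENNReal.rpow_two]
    exact hi r hr
  · rw [wH1m, ENNReal.ofReal_ofNat]
    set A := wLp 2 (fun r => ε r / (Real.sinh r : ℂ))
    set B := wLp 2 (deriv ε)
    have hsup : (⨆ r ∈ Set.Ioi (0:ℝ), (‖ε r‖₊ : ℝ≥0∞)) ≤ A + B := by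
      refine iSup₂_le fun r hr => ?_
      refine (ENNReal.pow_le_pow_left_iff two_ne_zero).1 ((hi r hr).trans ?_)
      calc 2 * (A * B) ≤ 2 * (A * B) + (A ^ 2 + B ^ 2) := le_self_add
        _ = (A + B) ^ 2 := by ring
    calc _ ≤ 2 * B + (A + B) := add_le_add hii hsup
      _ ≤ 2 * B + (A + B) + 2 * A := le_self_add
      _ = 3 * (B + A) := by ring

end
end

section
/- Virial positivity for the transformed linearized operator 𝓡_Q: for every nonzero u ∈ C_c^∞((0,∞),ℂ), Re ∫₀^∞ (𝓡_Q u)(r)·conj((Mu)(r))·sinh(r) dr > 0, while for every u ∈ C_c^∞((0,∞),ℂ) and every λ ∈ ℝ, Re ∫₀^∞ (λu)(r)·conj((Mu)(r))·sinh(r) dr = 0. In particular 𝓡_Q has no eigenfunction in C_c^∞((0,∞),ℂ). -/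
/- Virial positivity for the transformed linearized operator 𝓡_Q. -/

open MeasureTheory Set Filter
open scoped ENNReal NNReal Topology

noncomputable section

/-- Hyperbolic cotangent. -/
def hcoth (r : ℝ) : ℝ := Real.cosh r / Real.sinh r

/-- The multiplier weight `β(r) = (cosh r − 1)/sinh r`. -/
def betaw (r : ℝ) : ℝ := (Real.cosh r - 1) / Real.sinh r

/-- The potential
`W(r) = 1/sinh²r − (1−Q²)/2 + 2coth(r)(m−A)/sinh r + ((A−m)/sinh r)²`. -/
def Wpot (m : ℕ) (Q A : ℝ → ℝ) (r : ℝ) : ℝ :=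
  1 / Real.sinh r ^ 2 - (1 - Q r ^ 2) / 2
    + 2 * hcoth r * ((m:ℝ) - A r) / Real.sinh r
    + ((A r - m) / Real.sinh r) ^ 2

/-- The transformed linearized operator `𝓡_Q u = −u'' − coth(r)u' + u + W·u`. -/
def RQop (m : ℕ) (Q A : ℝ → ℝ) (u : ℝ → ℂ) (r : ℝ) : ℂ :=
  -deriv (deriv u) r - ((hcoth r : ℝ) : ℂ) * deriv u r + u r
    + ((Wpot m Q A r : ℝ) : ℂ) * u r

/-- The antisymmetric multiplier `M u = β u' + (β u)' + coth(r)·β u`. -/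
def Mop (u : ℝ → ℂ) (r : ℝ) : ℂ :=
  ((betaw r : ℝ) : ℂ) * deriv u r
    + deriv (fun s => ((betaw s : ℝ) : ℂ) * u s) r
    + ((hcoth r * betaw r : ℝ) : ℂ) * u r

lemma deriv_eq_zero_of_notMem_tsupport {u : ℝ → ℂ} {r : ℝ} (hr : r ∉ tsupport u) :
    deriv u r = 0 := by
  by_contra h
  exact hr (support_deriv_subset (f := u) h)

lemma integrableOn_Ioi_of_eq_zero_off_compact {E : Type*} [NormedAddCommGroup E]
    {f : ℝ → E} {K : Set ℝ} (hK : IsCompact K) (hK0 : K ⊆ Ioi 0)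
    (hf : ContinuousOn f (Ioi 0)) (hz : ∀ r ∉ K, f r = 0) : IntegrableOn f (Ioi 0) :=
  ((hf.mono hK0).integrableOn_compact hK).of_forall_sdiff_eq_zero measurableSet_Ioi
    fun r hr => hz r hr.2

/-- The derivative of a function supported in a compact subset of `(0,∞)` integrates to zero. -/
lemma integral_Ioi_deriv_eq_zero {F F' : ℝ → ℝ} {K : Set ℝ} (hK : IsCompact K)
    (hK0 : K ⊆ Ioi 0) (hF : ∀ r ∈ Ioi (0 : ℝ), HasDerivAt F (F' r) r)
    (hz : ∀ r ∉ K, F r = 0) (hint : IntegrableOn F' (Ioi 0)) :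
    ∫ r in Ioi (0 : ℝ), F' r = 0 := by
  have h0 : F =ᶠ[𝓝 0] fun _ => 0 := by
    filter_upwards [hK.isClosed.isOpen_compl.mem_nhds (fun h => lt_irrefl (0 : ℝ) (hK0 h))]
      with r hr using hz r hr
  have htop : F =ᶠ[atTop] fun _ => 0 := by
    obtain ⟨b, hb⟩ := hK.bddAbove
    filter_upwards [eventually_gt_atTop b] with r hr
    exact hz r fun h => (hb h).not_gt hr
  have := integral_Ioi_of_hasDerivAt_of_tendsto
    (continuousAt_const.congr h0.symm).continuousWithinAt hF hint
    (tendsto_const_nhds.congr' htop.symm)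
  rw [this, h0.eq_of_nhds, sub_zero]

lemma hasDerivAt_betaw {r : ℝ} (hr : 0 < r) :
    HasDerivAt betaw (1 - hcoth r * betaw r) r := by
  have hs : Real.sinh r ≠ 0 := (Real.sinh_pos_iff.2 hr).ne'
  refine (((Real.hasDerivAt_cosh r).sub_const 1).div (Real.hasDerivAt_sinh r) hs).congr_deriv ?_
  unfold hcoth betaw
  field_simp

/-- The zeroth-order part of the multiplier is the identity. -/
lemma Mop_eq {u : ℝ → ℂ} {r : ℝ} (hr : 0 < r) (hu : DifferentiableAt ℝ u r) :
    Mop u r = 2 * (betaw r : ℂ) * deriv u r + u r := by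
  have h : HasDerivAt (fun s => (betaw s : ℂ) * u s)
      (((1 - hcoth r * betaw r : ℝ) : ℂ) * u r + (betaw r : ℂ) * deriv u r) r :=
    (hasDerivAt_betaw hr).ofReal_comp.mul hu.hasDerivAt
  rw [Mop, h.deriv]
  push_cast
  ring

/-- Derivative of the potential, simplified by means of the Bogomolny equations. -/
def WpotDeriv (m : ℕ) (Q A : ℝ → ℝ) (r : ℝ) : ℝ :=
  -(2 * Real.cosh r / Real.sinh r ^ 3 + Real.cosh r * (1 - Q r ^ 2) / Real.sinh r
    + (m - A r) * (3 - 2 * Q r ^ 2) / Real.sinh r + 4 * (m - A r) / Real.sinh r ^ 3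
    + 2 * (m - A r) ^ 2 * Real.cosh r / Real.sinh r ^ 3)

lemma hasDerivAt_Wpot {m : ℕ} {Q A : ℝ → ℝ} {r : ℝ} (hr : 0 < r)
    (hQ : HasDerivAt Q ((m - A r) / Real.sinh r * Q r) r)
    (hA : HasDerivAt A (Real.sinh r * (1 - Q r ^ 2) / 2) r) :
    HasDerivAt (Wpot m Q A) (WpotDeriv m Q A r) r := by
  have hs : Real.sinh r ≠ 0 := (Real.sinh_pos_iff.2 hr).ne'
  have hS := Real.hasDerivAt_sinh r
  have hC := Real.hasDerivAt_cosh r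
  have h := ((((hasDerivAt_const r (1 : ℝ)).div (hS.pow 2) (pow_ne_zero 2 hs)).sub
    (((hQ.pow 2).const_sub 1).div_const 2)).add
    ((((hC.div hS hs).const_mul 2).mul (hA.const_sub (m : ℝ))).div hS hs)).add
    (((hA.sub_const (m : ℝ)).div hS hs).pow 2)
  refine h.congr_deriv ?_
  simp only [WpotDeriv, Pi.pow_apply, Pi.div_apply, Pi.mul_apply, Nat.add_one_sub_one, pow_one]
  have hcs : Real.cosh r ^ 2 = Real.sinh r ^ 2 + 1 := Real.cosh_sq r
  field_simp
  ring_nf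
  simp only [hcs]
  ring

lemma WpotDeriv_neg {m : ℕ} {Q A : ℝ → ℝ} {r : ℝ} (hr : 0 < r) (hQ0 : 0 < Q r) (hQ1 : Q r < 1)
    (hA : A r < m) : WpotDeriv m Q A r < 0 := by
  have hs : 0 < Real.sinh r := Real.sinh_pos_iff.2 hr
  have hc : 0 < Real.cosh r := Real.cosh_pos r
  have ha : 0 < m - A r := sub_pos.2 hA
  have h1 : 0 < 1 - Q r ^ 2 := by nlinarith
  have h2 : 0 < 3 - 2 * Q r ^ 2 := by nlinarith
  rw [WpotDeriv, neg_lt_zero]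
  positivity

/-- Pointwise virial identity for a real function: up to an exact derivative, the virial density
is `2β v'² - (cosh r - 1) W' v²`. -/
lemma hasDerivAt_virial {w v v1 : ℝ → ℝ} {w' v2 r : ℝ} (hr : 0 < r) (hw : HasDerivAt w w' r)
    (hv : HasDerivAt v (v1 r) r) (hv1 : HasDerivAt v1 v2 r) :
    HasDerivAt (fun t => -((Real.cosh t - 1) * v1 t ^ 2) - Real.sinh t * (v1 t * v t)
        + (1 + w t) * ((Real.cosh t - 1) * v t ^ 2))
      ((-v2 - hcoth r * v1 r + v r + w r * v r) * (2 * betaw r * v1 r + v r) * Real.sinh r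
        - (2 * betaw r * v1 r ^ 2 - (Real.cosh r - 1) * w' * v r ^ 2)) r := by
  have hs : Real.sinh r ≠ 0 := (Real.sinh_pos_iff.2 hr).ne'
  have hS := Real.hasDerivAt_sinh r
  have hC := (Real.hasDerivAt_cosh r).sub_const 1
  have h := ((hC.mul (hv1.pow 2)).neg.sub (hS.mul (hv1.mul hv))).add
    ((hw.const_add 1).mul (hC.mul (hv.pow 2)))
  refine h.congr_deriv ?_
  simp only [Pi.pow_apply, Pi.mul_apply, hcoth, betaw, Nat.add_one_sub_one, pow_one]
  have hcs : Real.cosh r ^ 2 = Real.sinh r ^ 2 + 1 := Real.cosh_sq r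
  field_simp
  ring_nf
  simp only [hcs]
  ring

lemma continuousOn_hcoth : ContinuousOn hcoth (Ioi 0) :=
  Real.continuous_cosh.continuousOn.div Real.continuous_sinh.continuousOn
    fun _ hr => (Real.sinh_pos_iff.2 hr).ne'

lemma continuousOn_betaw : ContinuousOn betaw (Ioi 0) :=
  fun _ hr => (hasDerivAt_betaw hr).continuousAt.continuousWithinAt

lemma continuousOn_WpotDeriv {m : ℕ} {Q A : ℝ → ℝ} (hQ : ContinuousOn Q (Ioi 0))
    (hA : ContinuousOn A (Ioi 0)) : ContinuousOn (WpotDeriv m Q A) (Ioi 0) := by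
  have hs : ∀ r ∈ Ioi (0 : ℝ), Real.sinh r ≠ 0 := fun _ hr => (Real.sinh_pos_iff.2 hr).ne'
  have hs3 : ∀ r ∈ Ioi (0 : ℝ), Real.sinh r ^ 3 ≠ 0 := fun r hr => pow_ne_zero 3 (hs r hr)
  have hS := Real.continuous_sinh.continuousOn (s := Ioi 0)
  have hC := Real.continuous_cosh.continuousOn (s := Ioi 0)
  unfold WpotDeriv
  fun_prop (disch := assumption)

lemma hasDerivAt_re_im {u : ℝ → ℂ} {r : ℝ} (hu : DifferentiableAt ℝ u r) :
    HasDerivAt (fun t => (u t).re) (deriv u r).re r ∧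
      HasDerivAt (fun t => (u t).im) (deriv u r).im r :=
  ⟨Complex.reCLM.hasFDerivAt.comp_hasDerivAt r hu.hasDerivAt,
    Complex.imCLM.hasFDerivAt.comp_hasDerivAt r hu.hasDerivAt⟩

/-- The virial density that remains after integration by parts. -/
def virialDensity (m : ℕ) (Q A : ℝ → ℝ) (u : ℝ → ℂ) (r : ℝ) : ℝ :=
  2 * betaw r * Complex.normSq (deriv u r)
    - (Real.cosh r - 1) * WpotDeriv m Q A r * Complex.normSq (u r)

lemma integral_virial_eq {m : ℕ} {Q A : ℝ → ℝ}
    (hQ : ∀ r ∈ Ioi (0 : ℝ), HasDerivAt Q ((m - A r) / Real.sinh r * Q r) r)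
    (hA : ∀ r ∈ Ioi (0 : ℝ), HasDerivAt A (Real.sinh r * (1 - Q r ^ 2) / 2) r)
    {u : ℝ → ℂ} (hu : ContDiff ℝ (⊤ : ℕ∞) u) (hc : HasCompactSupport u)
    (hsupp : tsupport u ⊆ Ioi 0) :
    IntegrableOn (virialDensity m Q A u) (Ioi 0) ∧
    (∫ r in Ioi (0 : ℝ), RQop m Q A u r * (starRingEnd ℂ) (Mop u r) * ((Real.sinh r : ℝ) : ℂ)).re
      = ∫ r in Ioi (0 : ℝ), virialDensity m Q A u r := by
  have hu1 : ContDiff ℝ (⊤ : ℕ∞) (deriv u) := (contDiff_infty_iff_deriv.1 hu).2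
  have hu2 : ContDiff ℝ (⊤ : ℕ∞) (deriv (deriv u)) := (contDiff_infty_iff_deriv.1 hu1).2
  have hd : Differentiable ℝ u := (contDiff_infty_iff_deriv.1 hu).1
  have hd1 : Differentiable ℝ (deriv u) := (contDiff_infty_iff_deriv.1 hu1).1
  have hz : ∀ r ∉ tsupport u, u r = 0 := fun r hr => image_eq_zero_of_notMem_tsupport hr
  have hz1 : ∀ r ∉ tsupport u, deriv u r = 0 := fun r hr => deriv_eq_zero_of_notMem_tsupport hr
  have hQc : ContinuousOn Q (Ioi 0) := fun r hr => (hQ r hr).continuousAt.continuousWithinAt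
  have hAc : ContinuousOn A (Ioi 0) := fun r hr => (hA r hr).continuousAt.continuousWithinAt
  have hW : ∀ r ∈ Ioi (0 : ℝ), HasDerivAt (Wpot m Q A) (WpotDeriv m Q A r) r :=
    fun r hr => hasDerivAt_Wpot hr (hQ r hr) (hA r hr)
  have hWc : ContinuousOn (Wpot m Q A) (Ioi 0) :=
    fun r hr => (hW r hr).continuousAt.continuousWithinAt
  have hWc' := continuousOn_WpotDeriv (m := m) hQc hAc
  have hbc := continuousOn_betaw
  have hhc := continuousOn_hcoth
  have hS := Real.continuous_sinh.continuousOn (s := Ioi 0)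
  have hC := Real.continuous_cosh.continuousOn (s := Ioi 0)
  have c0 := hu.continuous.continuousOn (s := Ioi 0)
  have c1 := hu1.continuous.continuousOn (s := Ioi 0)
  have c2 := hu2.continuous.continuousOn (s := Ioi 0)
  have hP : IntegrableOn (virialDensity m Q A u) (Ioi 0) := by
    refine integrableOn_Ioi_of_eq_zero_off_compact hc hsupp ?_ fun r hr => by
      simp [virialDensity, hz r hr, hz1 r hr]
    have n0 : ContinuousOn (fun r => Complex.normSq (u r)) (Ioi 0) :=
      Complex.continuous_normSq.comp_continuousOn c0
    have n1 : ContinuousOn (fun r => Complex.normSq (deriv u r)) (Ioi 0) :=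
      Complex.continuous_normSq.comp_continuousOn c1
    unfold virialDensity
    fun_prop
  set I : ℝ → ℂ := fun r =>
    RQop m Q A u r * (starRingEnd ℂ) (Mop u r) * ((Real.sinh r : ℝ) : ℂ) with hI
  have hIint : IntegrableOn I (Ioi 0) := by
    have h : IntegrableOn (fun r => RQop m Q A u r *
        (starRingEnd ℂ) (2 * (betaw r : ℂ) * deriv u r + u r) * ((Real.sinh r : ℝ) : ℂ))
        (Ioi 0) := by
      refine integrableOn_Ioi_of_eq_zero_off_compact hc hsupp ?_ fun r hr => by
        simp [hz r hr, hz1 r hr]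
      have b : ContinuousOn (fun r => (betaw r : ℂ)) (Ioi 0) :=
        Complex.continuous_ofReal.comp_continuousOn hbc
      have h : ContinuousOn (fun r => (hcoth r : ℂ)) (Ioi 0) :=
        Complex.continuous_ofReal.comp_continuousOn hhc
      have w : ContinuousOn (fun r => (Wpot m Q A r : ℂ)) (Ioi 0) :=
        Complex.continuous_ofReal.comp_continuousOn hWc
      have s : ContinuousOn (fun r => ((Real.sinh r : ℝ) : ℂ)) (Ioi 0) :=
        Complex.continuous_ofReal.comp_continuousOn hS
      have k : ContinuousOn (fun r => (starRingEnd ℂ) (2 * (betaw r : ℂ) * deriv u r + u r))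
          (Ioi 0) := Complex.continuous_conj.comp_continuousOn (by fun_prop)
      unfold RQop
      exact ((((c2.neg.sub (h.mul c1)).add c0).add (w.mul c0)).mul k).mul s
    refine h.congr_fun (fun r hr => ?_) measurableSet_Ioi
    simp only [hI, Mop_eq hr (hd r)]
  refine ⟨hP, ?_⟩
  have hre : (∫ r in Ioi (0 : ℝ), I r).re = ∫ r in Ioi (0 : ℝ), (I r).re :=
    (integral_re hIint).symm
  have hsub := integral_sub hIint.re hP
  rw [hre, ← sub_eq_zero]
  refine hsub.symm.trans ?_
  refine integral_Ioi_deriv_eq_zero hc hsupp (F := fun t =>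
    (-((Real.cosh t - 1) * (deriv u t).re ^ 2) - Real.sinh t * ((deriv u t).re * (u t).re)
        + (1 + Wpot m Q A t) * ((Real.cosh t - 1) * (u t).re ^ 2)) +
    (-((Real.cosh t - 1) * (deriv u t).im ^ 2) - Real.sinh t * ((deriv u t).im * (u t).im)
        + (1 + Wpot m Q A t) * ((Real.cosh t - 1) * (u t).im ^ 2))) (fun r hr => ?_)
    (fun r hr => by simp [hz r hr, hz1 r hr]) (hIint.re.sub hP)
  obtain ⟨hx, hy⟩ := hasDerivAt_re_im (hd r)
  obtain ⟨hx1, hy1⟩ := hasDerivAt_re_im (hd1 r)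
  refine ((hasDerivAt_virial hr (hW r hr) hx hx1).add
    (hasDerivAt_virial hr (hW r hr) hy hy1)).congr_deriv ?_
  simp only [hI, Mop_eq hr (hd r), RQop, virialDensity, Complex.normSq_apply]
  simp [-Complex.ofReal_sinh]
  ring

lemma integral_mul_conj_Mop_eq_zero {u : ℝ → ℂ} (hu : ContDiff ℝ (⊤ : ℕ∞) u)
    (hc : HasCompactSupport u) (hsupp : tsupport u ⊆ Ioi 0) (lam : ℝ) :
    (∫ r in Ioi (0 : ℝ),
      ((lam : ℂ) * u r) * (starRingEnd ℂ) (Mop u r) * ((Real.sinh r : ℝ) : ℂ)).re = 0 := by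
  have hd : Differentiable ℝ u := (contDiff_infty_iff_deriv.1 hu).1
  have hz : ∀ r ∉ tsupport u, u r = 0 := fun r hr => image_eq_zero_of_notMem_tsupport hr
  have c0 := hu.continuous.continuousOn (s := Ioi 0)
  have c1 := (contDiff_infty_iff_deriv.1 hu).2.continuous.continuousOn (s := Ioi 0)
  set I : ℝ → ℂ := fun r =>
    ((lam : ℂ) * u r) * (starRingEnd ℂ) (Mop u r) * ((Real.sinh r : ℝ) : ℂ) with hI
  have hIint : IntegrableOn I (Ioi 0) := by
    have h : IntegrableOn (fun r => ((lam : ℂ) * u r) *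
        (starRingEnd ℂ) (2 * (betaw r : ℂ) * deriv u r + u r) * ((Real.sinh r : ℝ) : ℂ))
        (Ioi 0) := by
      refine integrableOn_Ioi_of_eq_zero_off_compact hc hsupp ?_ fun r hr => by simp [hz r hr]
      have b : ContinuousOn (fun r => (betaw r : ℂ)) (Ioi 0) :=
        Complex.continuous_ofReal.comp_continuousOn continuousOn_betaw
      have s : ContinuousOn (fun r => ((Real.sinh r : ℝ) : ℂ)) (Ioi 0) :=
        (Complex.continuous_ofReal.comp Real.continuous_sinh).continuousOn
      have k : ContinuousOn (fun r => (starRingEnd ℂ) (2 * (betaw r : ℂ) * deriv u r + u r))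
          (Ioi 0) := Complex.continuous_conj.comp_continuousOn (by fun_prop)
      exact ((c0.const_mul (lam : ℂ)).mul k).mul s
    refine h.congr_fun (fun r hr => ?_) measurableSet_Ioi
    simp only [hI, Mop_eq hr (hd r)]
  have hre : (∫ r in Ioi (0 : ℝ), I r).re = ∫ r in Ioi (0 : ℝ), (I r).re :=
    (integral_re hIint).symm
  rw [hre]
  refine integral_Ioi_deriv_eq_zero hc hsupp (F := fun t =>
    lam * ((Real.cosh t - 1) * ((u t).re ^ 2 + (u t).im ^ 2))) (fun r hr => ?_)
    (fun r hr => by simp [hz r hr]) hIint.re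
  obtain ⟨hx, hy⟩ := hasDerivAt_re_im (hd r)
  refine ((((Real.hasDerivAt_cosh r).sub_const 1).mul
    ((hx.pow 2).add (hy.pow 2))).const_mul lam).congr_deriv ?_
  have hs : Real.sinh r ≠ 0 := (Real.sinh_pos_iff.2 hr).ne'
  simp only [hI, Mop_eq hr (hd r), betaw]
  simp [-Complex.ofReal_sinh, -Complex.ofReal_cosh, -Complex.ofReal_div]
  field_simp
  ring

lemma integral_virial_pos {m : ℕ} {Q A : ℝ → ℝ}
    (hQ : ∀ r ∈ Ioi (0 : ℝ), HasDerivAt Q ((m - A r) / Real.sinh r * Q r) r)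
    (hA : ∀ r ∈ Ioi (0 : ℝ), HasDerivAt A (Real.sinh r * (1 - Q r ^ 2) / 2) r)
    (hQpos : ∀ r ∈ Ioi (0 : ℝ), 0 < Q r) (hQlt1 : ∀ r ∈ Ioi (0 : ℝ), Q r < 1)
    (hAltm : ∀ r ∈ Ioi (0 : ℝ), A r < m)
    {u : ℝ → ℂ} (hu : ContDiff ℝ (⊤ : ℕ∞) u) (hc : HasCompactSupport u)
    (hsupp : tsupport u ⊆ Ioi 0) (hne : ∃ r, u r ≠ 0) :
    0 < (∫ r in Ioi (0 : ℝ),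
      RQop m Q A u r * (starRingEnd ℂ) (Mop u r) * ((Real.sinh r : ℝ) : ℂ)).re := by
  obtain ⟨hint, heq⟩ := integral_virial_eq hQ hA hu hc hsupp
  have hcosh : ∀ r ∈ Ioi (0 : ℝ), 0 < Real.cosh r - 1 :=
    fun r hr => sub_pos.2 (Real.one_lt_cosh.2 (ne_of_gt hr))
  have hkin : ∀ r ∈ Ioi (0 : ℝ), 0 ≤ 2 * betaw r * Complex.normSq (deriv u r) := fun r hr =>
    mul_nonneg (mul_nonneg zero_le_two (div_pos (hcosh r hr) (Real.sinh_pos_iff.2 hr)).le)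
      (Complex.normSq_nonneg _)
  have hWneg : ∀ r ∈ Ioi (0 : ℝ), (Real.cosh r - 1) * WpotDeriv m Q A r < 0 := fun r hr =>
    mul_neg_of_pos_of_neg (hcosh r hr)
      (WpotDeriv_neg hr (hQpos r hr) (hQlt1 r hr) (hAltm r hr))
  rw [heq, setIntegral_pos_iff_support_of_nonneg_ae ?_ hint]
  · have hopen : IsOpen (Function.support u) := hu.continuous.isOpen_support
    refine (hopen.measure_pos volume hne).trans_le (measure_mono fun r hr => ?_)
    have hr0 := hsupp (subset_tsupport u hr)
    refine ⟨ne_of_gt ?_, hr0⟩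
    have := mul_neg_of_neg_of_pos (hWneg r hr0) (Complex.normSq_pos.2 hr)
    have := hkin r hr0
    unfold virialDensity
    linarith
  · filter_upwards [ae_restrict_mem measurableSet_Ioi] with r hr
    have := mul_nonpos_of_nonpos_of_nonneg (hWneg r hr).le (Complex.normSq_nonneg (u r))
    have := hkin r hr
    simp only [virialDensity, Pi.zero_apply]
    linarith

/-- **Virial positivity for `𝓡_Q`:** `Re⟨𝓡_Q u, Mu⟩ > 0` for nonzero
`u ∈ C_c^∞((0,∞))`, while `Re⟨λu, Mu⟩ = 0` for every real `λ`; in particular `𝓡_Q`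
has no eigenfunction in `C_c^∞((0,∞))`. -/
theorem virial_positivity
    (m : ℕ) (hm : 1 ≤ m) (Q A : ℝ → ℝ)
    (hQsmooth : ContDiffOn ℝ (⊤ : ℕ∞) Q (Set.Ioi 0))
    (hAsmooth : ContDiffOn ℝ (⊤ : ℕ∞) A (Set.Ioi 0))
    (hBog1 : ∀ r ∈ Set.Ioi (0:ℝ), deriv Q r + (A r - m) / Real.sinh r * Q r = 0)
    (hBog2 : ∀ r ∈ Set.Ioi (0:ℝ), deriv A r = Real.sinh r * (1 - Q r ^ 2) / 2)
    (hQpos : ∀ r ∈ Set.Ioi (0:ℝ), 0 < Q r)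
    (hQlt1 : ∀ r ∈ Set.Ioi (0:ℝ), Q r < 1)
    (hAnonneg : ∀ r ∈ Set.Ioi (0:ℝ), 0 ≤ A r)
    (hAltm : ∀ r ∈ Set.Ioi (0:ℝ), A r < m) :
    -- positivity of the virial quantity on nonzero test functions
    (∀ u : ℝ → ℂ, ContDiff ℝ (⊤ : ℕ∞) u → HasCompactSupport u → tsupport u ⊆ Set.Ioi 0 →
      (∃ r, u r ≠ 0) →
      0 < (∫ r in Set.Ioi (0:ℝ),
        RQop m Q A u r * (starRingEnd ℂ) (Mop u r) * ((Real.sinh r : ℝ) : ℂ)).re) ∧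
    -- antisymmetry: Re⟨λu, Mu⟩ = 0
    (∀ u : ℝ → ℂ, ContDiff ℝ (⊤ : ℕ∞) u → HasCompactSupport u → tsupport u ⊆ Set.Ioi 0 →
      ∀ lam : ℝ,
      (∫ r in Set.Ioi (0:ℝ),
        ((lam : ℂ) * u r) * (starRingEnd ℂ) (Mop u r) * ((Real.sinh r : ℝ) : ℂ)).re = 0) ∧
    -- consequence: no compactly supported smooth eigenfunctions
    (∀ u : ℝ → ℂ, ContDiff ℝ (⊤ : ℕ∞) u → HasCompactSupport u → tsupport u ⊆ Set.Ioi 0 →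
      ∀ lam : ℝ, (∀ r ∈ Set.Ioi (0:ℝ), RQop m Q A u r = (lam : ℂ) * u r) →
      ∀ r, u r = 0) := by
  have hQ : ∀ r ∈ Ioi (0 : ℝ), HasDerivAt Q ((m - A r) / Real.sinh r * Q r) r := fun r hr =>
    (((hQsmooth.contDiffAt (Ioi_mem_nhds hr)).differentiableAt (by simp)).hasDerivAt).congr_deriv
      (by rw [eq_neg_of_add_eq_zero_left (hBog1 r hr)]; ring)
  have hA : ∀ r ∈ Ioi (0 : ℝ), HasDerivAt A (Real.sinh r * (1 - Q r ^ 2) / 2) r := fun r hr =>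
    (((hAsmooth.contDiffAt (Ioi_mem_nhds hr)).differentiableAt (by simp)).hasDerivAt).congr_deriv
      (hBog2 r hr)
  refine ⟨fun u hu hc hsupp hne => integral_virial_pos hQ hA hQpos hQlt1 hAltm hu hc hsupp hne,
    fun u hu hc hsupp lam => integral_mul_conj_Mop_eq_zero hu hc hsupp lam,
    fun u hu hc hsupp lam heig => ?_⟩
  by_contra! hne
  refine (integral_virial_pos hQ hA hQpos hQlt1 hAltm hu hc hsupp hne).ne' ?_
  refine Eq.trans ?_ (integral_mul_conj_Mop_eq_zero hu hc hsupp lam)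
  exact congrArg Complex.re
    (setIntegral_congr_fun measurableSet_Ioi fun r hr => by simp only [heig r hr])

end
end

section
/- Monotonicity of the linearized potential: V'(r) < 0 for every r > 0, where V(r) := 1/sinh²(r) − (1 − Q(r)²)/2 + 2 coth(r)·(m − A(r))/sinh(r) + ((A(r) − m)/sinh(r))². -/
/- Monotonicity of the linearized potential V. -/

open Set Filter
open scoped Topology

noncomputable section

/-- The linearized potential
`V(r) = 1/sinh²r − (1−Q²)/2 + 2coth(r)(m−A)/sinh r + ((A−m)/sinh r)²`. -/
def Vpot (m : ℕ) (Q A : ℝ → ℝ) (r : ℝ) : ℝ :=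
  1 / Real.sinh r ^ 2 - (1 - Q r ^ 2) / 2
    + 2 * hcoth r * ((m:ℝ) - A r) / Real.sinh r
    + ((A r - m) / Real.sinh r) ^ 2

/-- **Monotonicity of the linearized potential:** `V'(r) < 0` for every `r > 0`. -/
theorem Vpot_deriv_neg
    (m : ℕ) (hm : 1 ≤ m) (Q A : ℝ → ℝ)
    (hQsmooth : ContDiffOn ℝ (⊤ : ℕ∞) Q (Set.Ioi 0))
    (hAsmooth : ContDiffOn ℝ (⊤ : ℕ∞) A (Set.Ioi 0))
    (hBog1 : ∀ r ∈ Set.Ioi (0:ℝ), deriv Q r + (A r - m) / Real.sinh r * Q r = 0)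
    (hBog2 : ∀ r ∈ Set.Ioi (0:ℝ), deriv A r = Real.sinh r * (1 - Q r ^ 2) / 2)
    (hQnonneg : ∀ r ∈ Set.Ioi (0:ℝ), 0 ≤ Q r)
    (hQle1 : ∀ r ∈ Set.Ioi (0:ℝ), Q r ≤ 1)
    (hAlem : ∀ r ∈ Set.Ioi (0:ℝ), A r ≤ m) :
    ∀ r ∈ Set.Ioi (0:ℝ), deriv (Vpot m Q A) r < 0 := by
  intro r hr
  have hr0 : (0:ℝ) < r := hr
  have hs : 0 < Real.sinh r := Real.sinh_pos_iff.2 hr0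
  have hc : 0 < Real.cosh r := Real.cosh_pos r
  have hQd : HasDerivAt Q (-((A r - m) / Real.sinh r * Q r)) r := by
    rw [← eq_neg_of_add_eq_zero_left (hBog1 r hr)]
    exact ((hQsmooth.contDiffAt (Ioi_mem_nhds hr0)).differentiableAt (by simp)).hasDerivAt
  have hAd : HasDerivAt A (Real.sinh r * (1 - Q r ^ 2) / 2) r := by
    rw [← hBog2 r hr]
    exact ((hAsmooth.contDiffAt (Ioi_mem_nhds hr0)).differentiableAt (by simp)).hasDerivAt
  have hsd := Real.hasDerivAt_sinh r
  have hcd := Real.hasDerivAt_cosh r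
  have hV := ((((hasDerivAt_const r (1:ℝ)).div (hsd.pow 2) (pow_pos hs 2).ne').sub
    (((hQd.pow 2).const_sub 1).div_const 2)).add
    ((((hcd.div hsd hs.ne').const_mul 2).mul (hAd.const_sub (m:ℝ))).div hsd hs.ne')).add
    (((hAd.sub_const (m:ℝ)).div hsd hs.ne').pow 2)
  have hderiv : deriv (Vpot m Q A) r = _ := HasDerivAt.deriv (f := Vpot m Q A) hV
  have hcsq : Real.cosh r ^ 2 = 1 + Real.sinh r ^ 2 := by
    rw [Real.cosh_sq]; ring
  have hu : 0 ≤ (m - A r) / Real.sinh r := div_nonneg (sub_nonneg.2 (hAlem r hr)) hs.le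
  have hW : 0 ≤ (1 - Q r ^ 2) / 2 := by
    nlinarith [hQnonneg r hr, hQle1 r hr]
  have hformula : deriv (Vpot m Q A) r =
      -(2 * Real.cosh r / Real.sinh r ^ 3 + (m - A r) / Real.sinh r
        + 4 * ((m - A r) / Real.sinh r) / Real.sinh r ^ 2
        + 4 * ((m - A r) / Real.sinh r) * ((1 - Q r ^ 2) / 2)
        + 2 * (Real.cosh r / Real.sinh r) * ((1 - Q r ^ 2) / 2)
        + 2 * (Real.cosh r / Real.sinh r) * ((m - A r) / Real.sinh r) ^ 2) := by
    rw [hderiv]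
    simp only [Pi.div_apply, Pi.mul_apply, Pi.pow_apply, Nat.cast_ofNat, Nat.add_one_sub_one, pow_one]
    field_simp
    ring_nf
    simp only [hcsq]
    ring
  rw [hformula, neg_lt_zero]
  positivity

end
end
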